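/- arXiv:1711.10932 — 2 statements merged into one kernel-verified Lean document; each statement's English description precedes it below -/
import Mathlib

section
/- Let X be a separable complex Banach space, T a bounded operator on X, b ≥ 1, and x₁,…,x_N ∈ X. If the set {γ T^n x_i : γ ∈ ℂ, 1 ≤ |γ| ≤ b, n ∈ ℕ, 1 ≤ i ≤ N} is dense in X, then some x_i is a hypercyclic vector for T, i.e. {T^n x_i : n ∈ ℕ} is dense in X. -/
namespace HypercyclicOrbit

open Polynomial Set Topology Filter Pointwise

/-- A compact family of closed conditions has a closed projection. -/
lemma isClosed_exists_mem {A Y : Type*} [TopologicalSpace A] [TopologicalSpace Y] {K : Set A}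
    (hK : IsCompact K) {E : Set (A × Y)} (hE : IsClosed E) :
    IsClosed {y | ∃ k ∈ K, (k, y) ∈ E} := by
  have := isCompact_iff_compactSpace.mp hK
  have h := isClosedMap_snd_of_compactSpace (X := K) (Y := Y) _
    (hE.preimage (f := fun p : K × Y ↦ ((p.1 : A), p.2)) (by fun_prop))
  convert! h using 1
  ext y
  simp

variable {X : Type*} [NormedAddCommGroup X] [NormedSpace ℂ X]

/-- The orbit of `x` under the semigroup generated by `T` and the scalars in `Γ`. -/
def scaledOrbit (Γ : Submonoid ℂ) (T : X →L[ℂ] X) (x : X) : Set X :=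
  {y | ∃ γ ∈ Γ, ∃ n : ℕ, y = γ • (T ^ n) x}

variable {Γ : Submonoid ℂ} {T : X →L[ℂ] X} {x : X}

lemma self_mem_scaledOrbit : x ∈ scaledOrbit Γ T x := ⟨1, Γ.one_mem, 0, by simp⟩

lemma scaledOrbit_mono {Δ : Submonoid ℂ} (h : Γ ≤ Δ) : scaledOrbit Γ T x ⊆ scaledOrbit Δ T x :=
  fun _ ⟨γ, hγ, hy⟩ ↦ ⟨γ, h hγ, hy⟩

lemma smul_pow_mem_closure {γ : ℂ} (hγ : γ ∈ Γ) (n : ℕ) {y : X}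
    (hy : y ∈ closure (scaledOrbit Γ T x)) : γ • (T ^ n) y ∈ closure (scaledOrbit Γ T x) := by
  refine map_mem_closure (f := fun y ↦ γ • (T ^ n) y) (by fun_prop) hy ?_
  rintro _ ⟨δ, hδ, m, rfl⟩
  refine ⟨γ * δ, Γ.mul_mem hγ hδ, n + m, ?_⟩
  simp [pow_add, smul_smul]

lemma aeval_smul_pow (q : ℂ[X]) (γ : ℂ) (n : ℕ) (y : X) :
    aeval T q (γ • (T ^ n) y) = γ • (T ^ n) (aeval T q y) := by
  have h : Commute (aeval T q) (T ^ n) := by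
    simpa using (Commute.all q (Polynomial.X ^ n)).map (aeval T)
  rw [map_smul]
  congr 1
  exact congrArg (fun S : X →L[ℂ] X ↦ S y) h.eq

/-- A polynomial in `T` maps the whole scaled orbit closure of `x` into every closed set that is
stable under `T` and `Γ` and contains the image of `x`. -/
lemma mapsTo_aeval_closure {q : ℂ[X]} {D : Set X} (hD : IsClosed D)
    (hinv : ∀ γ ∈ Γ, ∀ n : ℕ, ∀ y ∈ D, γ • (T ^ n) y ∈ D) (hq : aeval T q x ∈ D) :
    MapsTo (aeval T q) (closure (scaledOrbit Γ T x)) D := by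
  refine MapsTo.closure_left ?_ (aeval T q).continuous hD
  rintro _ ⟨γ, hγ, n, rfl⟩
  rw [aeval_smul_pow]
  exact hinv γ hγ n _ hq

/-- An operator whose transpose has no eigenvalue: `T - a` has dense range. -/
lemma denseRange_sub_algebraMap (hφ : ∀ (φ : X →L[ℂ] ℂ) (a : ℂ), (∀ y, φ (T y) = a * φ y) → φ = 0)
    (a : ℂ) : DenseRange (aeval T (Polynomial.X - C a)) := by
  set S : X →L[ℂ] X := aeval T (Polynomial.X - C a) with hS
  by_contra hd
  set M : Submodule ℂ X := S.range.topologicalClosure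
  obtain ⟨y, hy⟩ : ∃ y, y ∉ M := by
    by_contra! hall
    exact hd fun y ↦ by
      have h := hall y
      rwa [← SetLike.mem_coe, Submodule.topologicalClosure_coe,
        show (S.range : Set X) = range S from LinearMap.coe_range _] at h
  have : IsClosed (M : Set X) := Submodule.isClosed_topologicalClosure _
  have hy0 : (Submodule.Quotient.mk y : X ⧸ M) ≠ 0 := by
    simpa [Submodule.Quotient.mk_eq_zero] using hy
  obtain ⟨g, hg⟩ := SeparatingDual.exists_ne_zero (R := ℂ) hy0
  have h0 := hφ (g.comp M.mkQL) a fun z ↦ by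
    have hz : S z ∈ M := Submodule.le_topologicalClosure _ ⟨z, rfl⟩
    have h1 : g (M.mkQL (S z)) = 0 := by
      have : M.mkQL (S z) = 0 := by simpa using hz
      rw [this, map_zero]
    have h2 : S z = T z - a • z := by simp [hS, Algebra.algebraMap_eq_smul_one]
    rw [h2, map_sub, map_sub, sub_eq_zero] at h1
    simpa using h1
  exact hg (by simpa using congrArg (fun f : X →L[ℂ] ℂ ↦ f y) h0)

lemma denseRange_aeval (hφ : ∀ (φ : X →L[ℂ] ℂ) (a : ℂ), (∀ y, φ (T y) = a * φ y) → φ = 0)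
    {q : ℂ[X]} (hq : q ≠ 0) : DenseRange (aeval T q) := by
  have hroots : ∀ s : Multiset ℂ, DenseRange (aeval T (s.map fun a ↦ Polynomial.X - C a).prod) := by
    intro s
    induction s using Multiset.induction with
    | empty => simpa using! Function.surjective_id.denseRange
    | cons a s ih =>
      rw [Multiset.map_cons, Multiset.prod_cons, map_mul]
      exact (denseRange_sub_algebraMap hφ a).comp ih (ContinuousLinearMap.continuous _)
  rw [(IsAlgClosed.splits q).eq_prod_roots, map_mul]
  refine DenseRange.comp (g := aeval T (C q.leadingCoeff)) (Function.Surjective.denseRange ?_)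
    (hroots _) (ContinuousLinearMap.continuous _)
  intro y
  exact ⟨q.leadingCoeff⁻¹ • y, by
    simp [Algebra.algebraMap_eq_smul_one, smul_smul, leadingCoeff_ne_zero.mpr hq]⟩

/-- A nontrivial multiple of `x` that is a limit of its orbit is a limit of the orbit of `T x`. -/
lemma smul_mem_closure_range_pow_succ (hx : x ≠ 0) {γ : ℂ} (hγ : γ ≠ 1)
    (h : γ • x ∈ closure (range fun n : ℕ ↦ (T ^ n) x)) :
    γ • x ∈ closure (range fun n : ℕ ↦ (T ^ (n + 1)) x) := by
  have hrange : (range fun n : ℕ ↦ (T ^ n) x) = {x} ∪ range fun n : ℕ ↦ (T ^ (n + 1)) x := by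
    ext y
    constructor
    · rintro ⟨_ | n, rfl⟩
      · simp
      · exact Or.inr ⟨n, rfl⟩
    · rintro (rfl | ⟨n, rfl⟩)
      · exact ⟨0, by simp⟩
      · exact ⟨n + 1, rfl⟩
  rw [hrange, closure_union, closure_singleton] at h
  refine h.resolve_left fun heq ↦ hγ ?_
  have h1 : (γ - 1) • x = 0 := by
    rw [sub_smul, one_smul, sub_eq_zero]
    exact heq
  exact sub_eq_zero.mp ((smul_eq_zero.mp h1).resolve_right hx)

lemma scaledOrbit_bot : scaledOrbit ⊥ T x = range fun n : ℕ ↦ (T ^ n) x := by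
  ext y
  simp [scaledOrbit, eq_comm]

/-- Bourdon–Feldman for projective orbits: a somewhere dense projective orbit of a recurrent
vector is dense, if every nonzero polynomial in `T` has dense range. -/
theorem closure_projectiveOrbit_eq_univ (hT : ∀ q : ℂ[X], q ≠ 0 → DenseRange (aeval T q))
    (hrec : x ∈ closure (scaledOrbit (nonZeroDivisors ℂ) T (T x)))
    (hinter : (interior (closure (scaledOrbit (nonZeroDivisors ℂ) T x))).Nonempty) :
    closure (scaledOrbit (nonZeroDivisors ℂ) T x) = univ := by
  set F := closure (scaledOrbit (nonZeroDivisors ℂ) T x) with hF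
  set U := interior F with hU
  have hFc : IsClosed F := isClosed_closure
  have hUo : IsOpen U := isOpen_interior
  have hUF : U ⊆ F := interior_subset
  have hsmulF : ∀ c : ℂ, c ≠ 0 → ∀ y ∈ F, c • y ∈ F := fun c hc y hy ↦ by
    simpa using smul_pow_mem_closure (mem_nonZeroDivisors_iff_ne_zero.mpr hc) 0 hy
  have hsmulU : ∀ c : ℂ, c ≠ 0 → ∀ y ∈ U, c • y ∈ U := fun c hc y hy ↦ by
    refine interior_maximal (s := F) (t := c • U) ?_ (hUo.smul₀ hc) (smul_mem_smul_set hy)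
    rintro _ ⟨z, hz, rfl⟩
    exact hsmulF c hc z (hUF hz)
  have hpoly : Dense (range fun q : ℂ[X] ↦ aeval T q x) := by
    let M : Submodule ℂ X := (LinearMap.range
      ((LinearMap.applyₗ x ∘ₗ ContinuousLinearMap.coeLM ℂ) ∘ₗ
        (aeval T : ℂ[X] →ₐ[ℂ] X →L[ℂ] X).toLinearMap)).topologicalClosure
    have hM : (M : Set X) = closure (range fun q : ℂ[X] ↦ aeval T q x) := by
      rw [Submodule.topologicalClosure_coe]
      rfl
    have hFM : F ⊆ M := by
      rw [hM]
      refine closure_mono ?_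
      rintro _ ⟨c, -, n, rfl⟩
      exact ⟨C c * Polynomial.X ^ n, by simp [Algebra.algebraMap_eq_smul_one]⟩
    have : M = ⊤ := M.eq_top_of_nonempty_interior' (hinter.mono (interior_mono hFM))
    rw [dense_iff_closure_eq, ← hM, this]
    rfl
  have hTU : ∀ y ∈ Uᶜ, T y ∈ Uᶜ := by
    intro y hy hTy
    rw [hU, ← closure_compl] at hy
    obtain ⟨z, hz, hzF⟩ := mem_closure_iff.mp hy _ (hUo.preimage T.continuous) hTy
    obtain ⟨_, ⟨hz1, hz2⟩, q, rfl⟩ := hpoly.inter_open_nonempty _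
      ((hUo.preimage T.continuous).inter hFc.isOpen_compl) ⟨z, hz, hzF⟩
    refine hz2 (mapsTo_aeval_closure (Γ := nonZeroDivisors ℂ) (x := T x) hFc
      (fun γ hγ n y hy ↦ smul_pow_mem_closure hγ n hy) ?_ hrec)
    have h := aeval_smul_pow (T := T) q 1 1 x
    simp only [one_smul, pow_one] at h
    rw [h]
    exact hUF hz1
  have hinvU : ∀ γ ∈ nonZeroDivisors ℂ, ∀ n : ℕ, ∀ y ∈ Uᶜ, γ • (T ^ n) y ∈ Uᶜ := by
    intro γ hγ n y hy
    have hγ := mem_nonZeroDivisors_iff_ne_zero.mp hγ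
    have hn : (T ^ n) y ∈ Uᶜ := by
      induction n with
      | zero => simpa using hy
      | succ n ih => rw [pow_succ']; exact hTU _ ih
    intro h
    exact hn (by simpa [smul_smul, hγ] using hsmulU γ⁻¹ (inv_ne_zero hγ) _ h)
  have hmaps : ∀ q : ℂ[X], aeval T q x ∈ Uᶜ → MapsTo (aeval T q) F Uᶜ := fun q hq ↦
    mapsTo_aeval_closure hUo.isClosed_compl hinvU hq
  have hbdry : ∀ p : ℂ[X], p ≠ 0 → aeval T p x ∈ F → aeval T p x ∈ U := by
    intro p hp hpF
    by_contra hpU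
    have hpq : ∀ q : ℂ[X], aeval T p (aeval T q x) ∈ Uᶜ := by
      intro q
      by_cases hq : aeval T q x ∈ U
      · exact hmaps p hpU (hUF hq)
      · have := hmaps q hq hpF
        rwa [← mul_apply_eq_comp, ← map_mul, mul_comm, map_mul] at this
    have hd : Dense (range fun q : ℂ[X] ↦ aeval T p (aeval T q x)) :=
      (hT p hp).comp hpoly (aeval T p).continuous
    obtain ⟨_, hy, q, rfl⟩ := hd.inter_open_nonempty U hUo hinter
    exact hpq q hy
  obtain ⟨q₀, hq₀, hq₀U⟩ : ∃ q : ℂ[X], q ≠ 0 ∧ aeval T q x ∈ U := by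
    obtain ⟨y, hy⟩ := hinter
    obtain ⟨_, hz, c, hc, n, rfl⟩ := mem_closure_iff.mp (hUF hy) U hUo hy
    refine ⟨C c * Polynomial.X ^ n, ?_, by simpa [Algebra.algebraMap_eq_smul_one] using hz⟩
    simpa using mem_nonZeroDivisors_iff_ne_zero.mp hc
  have hall : ∀ q : ℂ[X], q ≠ 0 → aeval T q x ∈ U := by
    intro q hq
    by_cases hlin : ∃ c : ℂ, q = C c * q₀
    · obtain ⟨c, rfl⟩ := hlin
      have hc : c ≠ 0 := by rintro rfl; simp at hq
      simpa [Algebra.algebraMap_eq_smul_one] using hsmulU c hc _ hq₀U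
    have hne : ∀ t : ℂ, C (1 - t) * q₀ + C t * q ≠ 0 := by
      intro t ht
      by_cases h0 : t = 0
      · simp [h0, hq₀] at ht
      · refine hlin ⟨-(t⁻¹ * (1 - t)), ?_⟩
        have h1 : C t⁻¹ * C t = 1 := by rw [← C_mul, inv_mul_cancel₀ h0, C_1]
        rw [C_neg, C_mul]
        linear_combination C t⁻¹ * ht - q * h1
    let u : ℂ → X := fun t ↦ aeval T (C (1 - t) * q₀ + C t * q) x
    have hu : Continuous u := by
      simp only [u, map_add, map_mul, aeval_C, Algebra.algebraMap_eq_smul_one]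
      simp only [add_apply, mul_apply_eq_comp,
        smul_apply, one_apply_eq_self]
      fun_prop
    have hclopen : IsClopen (u ⁻¹' U) := by
      refine ⟨?_, hUo.preimage hu⟩
      have : u ⁻¹' U = u ⁻¹' F := by
        ext t
        exact ⟨fun h ↦ hUF h, fun h ↦ hbdry _ (hne t) h⟩
      rw [this]
      exact hFc.preimage hu
    have h1 : (1 : ℂ) ∈ u ⁻¹' U := by
      rw [hclopen.eq_univ ⟨0, by simpa [u] using hq₀U⟩]
      trivial
    simpa [u] using h1
  have h0 : (0 : X) ∈ F := by
    have hl : Tendsto (fun c : ℂ ↦ c • x) (𝓝[≠] 0) (𝓝 0) := by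
      have : Tendsto (fun c : ℂ ↦ c • x) (𝓝 0) (𝓝 ((0 : ℂ) • x)) :=
        Continuous.tendsto (by fun_prop) _
      rw [zero_smul] at this
      exact this.mono_left nhdsWithin_le_nhds
    refine hFc.mem_of_tendsto hl ?_
    filter_upwards [self_mem_nhdsWithin] with c hc
    exact hsmulF c hc x (subset_closure self_mem_scaledOrbit)
  refine eq_univ_of_univ_subset ?_
  rw [← hpoly.closure_eq]
  refine closure_minimal ?_ hFc
  rintro _ ⟨q, rfl⟩
  by_cases hq : q = 0
  · simpa [hq] using h0
  · exact hUF (hall q hq)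

lemma neg_mem_of_isClosed {P : AddSubmonoid ℝ} (hP : IsClosed (P : Set ℝ)) {p q : ℝ} (hp : p ∈ P)
    (hp0 : 0 < p) (hq : q ∈ P) (hq0 : q < 0) : -q ∈ P := by
  let k : ℕ → ℕ := fun n ↦ ⌈n * (-q) / p⌉₊
  have hk : ∀ n, n * q + k n * p ∈ Icc 0 p := by
    intro n
    have h0 : 0 ≤ n * (-q) / p := div_nonneg (mul_nonneg n.cast_nonneg (by linarith)) hp0.le
    have h1 := (div_le_iff₀ hp0).mp (Nat.le_ceil (n * (-q) / p))
    have h2 := mul_lt_mul_of_pos_right (Nat.ceil_lt_add_one h0) hp0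
    rw [add_mul, div_mul_cancel₀ _ hp0.ne'] at h2
    constructor <;> simp only [k] <;> linarith
  have hmono : Monotone k := fun m n hmn ↦ Nat.ceil_mono (by gcongr; linarith)
  obtain ⟨l, -, φ, hφ, hl⟩ := isCompact_Icc.tendsto_subseq hk
  have hlim := ((hl.comp (tendsto_add_atTop_nat 1)).sub hl).sub_const q
  rw [sub_self, zero_sub] at hlim
  refine hP.mem_of_tendsto hlim (Eventually.of_forall fun n ↦ ?_)
  have hlt : φ n < φ (n + 1) := hφ n.lt_succ_self
  obtain ⟨d, hd⟩ := Nat.exists_eq_add_of_lt hlt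
  obtain ⟨j, hj⟩ := Nat.exists_eq_add_of_le (hmono hlt.le)
  have : d • q + j • p ∈ P := P.add_mem (P.nsmul_mem hq d) (P.nsmul_mem hp j)
  convert! this using 1
  simp only [Function.comp_apply, nsmul_eq_mul, hj]
  rw [hd]
  push_cast
  ring

/-- A closed additive submonoid of `ℝ` with elements of both signs is a closed subgroup. -/
lemma eq_top_or_cyclic_of_isClosed (P : AddSubmonoid ℝ) (hP : IsClosed (P : Set ℝ))
    (hpos : ∃ p ∈ P, 0 < p) (hneg : ∃ q ∈ P, q < 0) :
    (∀ θ, θ ∈ P) ∨ ∃ a : ℝ, 0 < a ∧ ∀ θ, θ ∈ P ↔ ∃ k : ℤ, θ = k * a := by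
  obtain ⟨p, hp, hp0⟩ := hpos
  obtain ⟨q, hq, hq0⟩ := hneg
  let H : AddSubgroup ℝ :=
    { P with
      neg_mem' := by
        intro r hr
        rcases lt_trichotomy r 0 with h | h | h
        · exact neg_mem_of_isClosed hP hp hp0 hr h
        · simp [h]
        · have := neg_mem_of_isClosed (P := P.comap (-AddMonoidHom.id ℝ))
            (p := -q) (q := -r) (hP.preimage continuous_neg) (by simpa using hq) (by linarith)
            (by simpa using hr) (by linarith)
          simpa using this }
  rcases H.dense_or_cyclic with hd | ⟨a, ha⟩
  · left
    intro θ
    have : (P : Set ℝ) = univ := by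
      rw [← hP.closure_eq]
      exact hd.closure_eq
    rw [← SetLike.mem_coe, this]
    trivial
  · right
    have hmem : ∀ θ, θ ∈ P ↔ ∃ k : ℤ, k * a = θ := by
      intro θ
      have : θ ∈ P ↔ θ ∈ H := Iff.rfl
      rw [this, ha, AddSubgroup.mem_closure_singleton]
      simp
    have ha0 : a ≠ 0 := by
      rintro rfl
      obtain ⟨k, hk⟩ := (hmem p).mp hp
      simp at hk
      exact hp0.ne hk
    rcases ha0.lt_or_gt with h | h
    · refine ⟨-a, by linarith, fun θ ↦ (hmem θ).trans ⟨?_, ?_⟩⟩ <;> rintro ⟨k, hk⟩ <;>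
        exact ⟨-k, by push_cast; linarith⟩
    · exact ⟨a, h, fun θ ↦ (hmem θ).trans (by simp [eq_comm])⟩

/-- A closed relation whose fibres are cosets of `aℤ` admits a continuous selection over a simply
connected space. -/
lemma exists_continuous_selection {A : Type*} [TopologicalSpace A] [SimplyConnectedSpace A]
    [LocallyPathConnectedSpace A] {a : ℝ} (ha : 0 < a) {E : Set (ℝ × A)} (hE : IsClosed E)
    (hne : ∀ α, ∃ θ, (θ, α) ∈ E)
    (hcoset : ∀ α θ, (θ, α) ∈ E → ∀ θ', (θ', α) ∈ E ↔ ∃ k : ℤ, θ' - θ = k * a) :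
    ∃ G : A → ℝ, Continuous G ∧ ∀ α, (G α, α) ∈ E := by
  choose s hs using hne
  have hcoe : ∀ α (θ : ℝ), ((θ : AddCircle a) = s α) ↔ (θ, α) ∈ E := by
    intro α θ
    rw [hcoset α _ (hs α), ← sub_eq_zero, ← AddCircle.coe_sub, AddCircle.coe_eq_zero_iff]
    simp [eq_comm]
  have hg : Continuous fun α ↦ (s α : AddCircle a) := by
    rw [continuous_iff_isClosed]
    intro D hD
    have hcl := isClosed_exists_mem 
      (isCompact_Icc (a := (0 : ℝ)) (b := a)) (hE.inter
      (hD.preimage (f := fun p : ℝ × A ↦ (p.1 : AddCircle a))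
        ((AddCircle.continuous_mk' a).comp continuous_fst)))
    convert! hcl using 1
    ext α
    constructor
    · intro hα
      have : Fact (0 < a) := ⟨ha⟩
      obtain ⟨θ, hθ, hθs⟩ := (AddCircle.coe_image_Icc_eq a 0).ge (mem_univ (s α : AddCircle a))
      refine ⟨θ, by simpa using hθ, (hcoe α θ).mp hθs, ?_⟩
      rw [mem_preimage] at hα ⊢
      rwa [← hθs] at hα
    · rintro ⟨θ, -, hθE, hθD⟩
      rw [mem_preimage] at hθD ⊢
      rwa [← (hcoe α θ).mpr hθE]
  obtain ⟨α₀⟩ : Nonempty A := inferInstance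
  obtain ⟨G, ⟨-, hG⟩, -⟩ := (AddCircle.isCoveringMap_coe a).existsUnique_continuousMap_lifts
    ⟨_, hg⟩ α₀ (s α₀) rfl
  exact ⟨G, G.continuous, fun α ↦ (hcoe α _).mp (congrFun hG α)⟩

/-- The `θ` such that `y` lies in the translate `exp (θ ζ) • D`. -/
def shifts (D : Set X) (ζ : ℂ) (y : X) : Set ℝ := {θ | Complex.exp (-(θ * ζ)) • y ∈ D}

lemma add_mem_shifts_iff {D : Set X} {ζ : ℂ} {y : X} {θ τ : ℝ} : θ + τ ∈ shifts D ζ y ↔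
    Complex.exp (-(θ * ζ)) • Complex.exp (-(τ * ζ)) • y ∈ D := by
  rw [smul_smul, ← Complex.exp_add, ← neg_add, ← add_mul, ← Complex.ofReal_add]
  rfl

lemma isClosed_shifts_graph {A : Type*} [TopologicalSpace A] {D : Set X} (hD : IsClosed D) (ζ : ℂ)
    {u : A → X} (hu : Continuous u) : IsClosed {p : ℝ × A | p.1 ∈ shifts D ζ (u p.2)} :=
  hD.preimage (f := fun p : ℝ × A ↦ Complex.exp (-(p.1 * ζ)) • u p.2) (by fun_prop)

/-- A closed set `D` containing `x`, like an orbit closure of `x`, whose translates by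
`exp (θ ζ)`, for bounded `θ`, cover the space. -/
structure IsShiftCover (T : X →L[ℂ] X) (x : X) (D : Set X) (ζ : ℂ) : Prop where
  isClosed : IsClosed D
  self_mem : x ∈ D
  apply_mem : T x ∈ D
  mapsTo : ∀ q : ℂ[X], aeval T q x ∈ D → MapsTo (aeval T q) D D
  cover : ∃ L : ℝ, ∀ y, ∃ θ ∈ Icc (-L) L, θ ∈ shifts D ζ y

namespace IsShiftCover

variable {D : Set X} {ζ : ℂ} {a : ℝ}

lemma smul_mapsTo (h : IsShiftCover T x D ζ) {c : ℂ} {q : ℂ[X]} (hq : c • aeval T q x ∈ D) {y : X}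
    (hy : y ∈ D) : c • aeval T q y ∈ D := by
  simpa [Algebra.algebraMap_eq_smul_one] using
    h.mapsTo (C c * q) (by simpa [Algebra.algebraMap_eq_smul_one] using hq) hy

lemma apply_mapsTo (h : IsShiftCover T x D ζ) {y : X} (hy : y ∈ D) : T y ∈ D := by
  simpa using h.mapsTo Polynomial.X (by simpa using h.apply_mem) hy

lemma pow_mem (h : IsShiftCover T x D ζ) (n : ℕ) : (T ^ n) x ∈ D := by
  induction n with
  | zero => simpa using h.self_mem
  | succ n ih => rw [pow_succ']; exact h.apply_mapsTo ih

lemma shifts_subset_apply (h : IsShiftCover T x D ζ) (y : X) :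
    shifts D ζ y ⊆ shifts D ζ (T y) := fun θ hθ ↦ by
  simpa [shifts] using h.apply_mapsTo hθ

lemma add_mem_shifts (h : IsShiftCover T x D ζ) {θ τ : ℝ} (hθ : θ ∈ shifts D ζ x) {y : X}
    (hτ : τ ∈ shifts D ζ y) : θ + τ ∈ shifts D ζ y := by
  simpa [add_mem_shifts_iff] using h.smul_mapsTo (q := 1) (by simpa using! hθ) hτ

/-- Either `D` is everything or the shifts of `x` form a discrete subgroup. -/
lemma eq_univ_or_cyclic (h : IsShiftCover T x D ζ) :
    D = univ ∨ ∃ a : ℝ, 0 < a ∧ ∀ θ, θ ∈ shifts D ζ x ↔ ∃ k : ℤ, θ = k * a := by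
  obtain ⟨L, hL⟩ := h.cover
  let P : AddSubmonoid ℝ :=
    { carrier := shifts D ζ x
      zero_mem' := by simpa [shifts] using h.self_mem
      add_mem' := fun hθ hτ ↦ h.add_mem_shifts hθ hτ }
  have hP : IsClosed (P : Set ℝ) :=
    h.isClosed.preimage (f := fun θ : ℝ ↦ Complex.exp (-(θ * ζ)) • x) (by fun_prop)
  have hshift : ∀ τ : ℝ, ∃ θ ∈ Icc (-L) L, θ + τ ∈ P := by
    intro τ
    obtain ⟨θ, hθ, hθD⟩ := hL (Complex.exp (-(τ * ζ)) • x)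
    exact ⟨θ, hθ, add_mem_shifts_iff.mpr hθD⟩
  obtain ⟨θ₁, hθ₁, hP₁⟩ := hshift (L + 1)
  obtain ⟨θ₂, hθ₂, hP₂⟩ := hshift (-L - 1)
  rcases eq_top_or_cyclic_of_isClosed P hP ⟨_, hP₁, by linarith [hθ₁.1]⟩
    ⟨_, hP₂, by linarith [hθ₂.2]⟩ with htop | hcyc
  · left
    refine eq_univ_of_forall fun y ↦ ?_
    obtain ⟨θ, -, hθ⟩ := hL y
    simpa [shifts] using h.add_mem_shifts (htop (-θ)) hθ
  · exact Or.inr hcyc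

/-- The shifts of `q(T) x` form a coset of the shifts of `x`. -/
lemma mem_shifts_iff (h : IsShiftCover T x D ζ)
    (hP : ∀ θ, θ ∈ shifts D ζ x ↔ ∃ k : ℤ, θ = k * a) {q : ℂ[X]}
    (hq : DenseRange (aeval T q)) {θ : ℝ} (hθ : θ ∈ shifts D ζ (aeval T q x)) (θ' : ℝ) :
    θ' ∈ shifts D ζ (aeval T q x) ↔ ∃ k : ℤ, θ' - θ = k * a := by
  obtain ⟨L, hL⟩ := h.cover
  have hcl := isClosed_exists_mem (isCompact_Icc (a := -L) (b := L))
    (isClosed_shifts_graph (isClosed_closure (s := aeval T q '' D)) ζ continuous_id)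
  obtain ⟨s, -, hs⟩ : x ∈ {y | ∃ s ∈ Icc (-L) L, s ∈ shifts (closure (aeval T q '' D)) ζ y} := by
    refine closure_minimal (t := {y | _}) ?_ hcl (hq x)
    rintro _ ⟨y, rfl⟩
    obtain ⟨s, hs, hsD⟩ := hL y
    exact ⟨s, hs, subset_closure ⟨_, hsD, by simp⟩⟩
  have hadd : ∀ τ ∈ shifts D ζ (aeval T q x), τ + s ∈ shifts D ζ x := by
    intro τ hτ
    have hm : MapsTo (fun y ↦ Complex.exp (-(τ * ζ)) • y) (closure (aeval T q '' D)) D := by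
      refine MapsTo.closure_left ?_ (by fun_prop) h.isClosed
      rintro _ ⟨y, hy, rfl⟩
      exact h.smul_mapsTo hτ hy
    exact add_mem_shifts_iff.mpr (hm hs)
  constructor
  · intro hθ'
    obtain ⟨k, hk⟩ := (hP _).mp (hadd θ hθ)
    obtain ⟨k', hk'⟩ := (hP _).mp (hadd θ' hθ')
    exact ⟨k' - k, by push_cast; linarith⟩
  · rintro ⟨k, hk⟩
    have := h.add_mem_shifts ((hP (k * a)).mpr ⟨k, rfl⟩) hθ
    rwa [← hk, sub_add_cancel] at this

/-- Shifts can be chosen continuously along families of nonzero polynomials. -/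
lemma exists_lift (h : IsShiftCover T x D ζ) (ha : 0 < a)
    (hP : ∀ θ, θ ∈ shifts D ζ x ↔ ∃ k : ℤ, θ = k * a)
    (hT : ∀ q : ℂ[X], q ≠ 0 → DenseRange (aeval T q))
    {A : Type*} [TopologicalSpace A] [SimplyConnectedSpace A] [LocallyPathConnectedSpace A]
    (u : A → ℂ[X]) (hu : ∀ α, u α ≠ 0) (huc : Continuous fun α ↦ aeval T (u α) x) :
    ∃ G : A → ℝ, Continuous G ∧ ∀ α, G α ∈ shifts D ζ (aeval T (u α) x) := by
  obtain ⟨L, hL⟩ := h.cover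
  refine exists_continuous_selection ha (isClosed_shifts_graph h.isClosed ζ huc) (fun α ↦ ?_)
    fun α θ hθ θ' ↦ h.mem_shifts_iff hP (hT _ (hu α)) hθ θ'
  obtain ⟨θ, -, hθ⟩ := hL (aeval T (u α) x)
  exact ⟨θ, hθ⟩

lemma eq_of_forall_eq_int_mul {A : Type*} [TopologicalSpace A] [PreconnectedSpace A] {f : A → ℝ}
    (hf : Continuous f) (hfa : ∀ α, ∃ k : ℤ, f α = k * a) (α β : A) : f α = f β :=
  isPreconnected_univ.constant_of_mapsTo (S := univ) (T := (AddSubgroup.zmultiples a : Set ℝ))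
    ⟨inferInstanceAs (DiscreteTopology (AddSubgroup.zmultiples a))⟩
    hf.continuousOn (fun α _ ↦ by
      obtain ⟨k, hk⟩ := hfa α
      exact ⟨k, by simp [hk]⟩)
    (mem_univ α) (mem_univ β)

/-- Continuous choices of shifts along the same family have the same increments. -/
lemma sub_eq_sub (h : IsShiftCover T x D ζ)
    (hP : ∀ θ, θ ∈ shifts D ζ x ↔ ∃ k : ℤ, θ = k * a)
    (hT : ∀ q : ℂ[X], q ≠ 0 → DenseRange (aeval T q))
    {A : Type*} [TopologicalSpace A] [PreconnectedSpace A] {u : A → ℂ[X]} (hu : ∀ α, u α ≠ 0)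
    {G G' : A → ℝ} (hG : Continuous G) (hG' : Continuous G')
    (hGu : ∀ α, G α ∈ shifts D ζ (aeval T (u α) x))
    (hGu' : ∀ α, G' α ∈ shifts D ζ (aeval T (u α) x)) (α β : A) :
    G α - G β = G' α - G' β := by
  have : G α - G' α = G β - G' β := eq_of_forall_eq_int_mul (hG.sub hG') (fun α ↦
    (h.mem_shifts_iff hP (hT _ (hu α)) (hGu' α) _).mp (hGu α)) α β
  linarith

/-- The segment of polynomials from `1` to `X ^ (n + 1)`, extended to a line. -/
noncomputable def powerLine (n : ℕ) (s : ℝ) : ℂ[X] :=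
  C (1 - (s : ℂ)) + C (s : ℂ) * Polynomial.X ^ (n + 1)

lemma C_add_C_mul_X_pow_ne_zero {α β : ℂ} (hαβ : α ≠ 0 ∨ β ≠ 0) (n : ℕ) :
    C α + C β * Polynomial.X ^ (n + 1) ≠ 0 := by
  intro h0
  have h1 := congrArg (coeff · 0) h0
  have h2 := congrArg (coeff · (n + 1)) h0
  simp [coeff_C] at h1 h2
  tauto

lemma aeval_C_add_C_mul_X_pow (α β : ℂ) (n : ℕ) :
    aeval T (C α + C β * Polynomial.X ^ (n + 1)) x = α • x + β • (T ^ (n + 1)) x := by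
  simp [Algebra.algebraMap_eq_smul_one]

lemma powerLine_ne_zero (n : ℕ) (s : ℝ) : powerLine n s ≠ 0 := by
  refine C_add_C_mul_X_pow_ne_zero ?_ n
  by_contra! hs
  simp [hs.2] at hs

lemma continuous_aeval_powerLine (n : ℕ) : Continuous fun s ↦ aeval T (powerLine n s) x := by
  simp only [powerLine, aeval_C_add_C_mul_X_pow]
  fun_prop

/-- The total change of the shift along the segment from `x` to `T ^ (n + 1) x` is `δ`. -/
def HasIncrement (T : X →L[ℂ] X) (x : X) (D : Set X) (ζ : ℂ) (n : ℕ) (δ : ℝ) : Prop :=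
  ∃ G : ℝ → ℝ, Continuous G ∧ (∀ s, G s ∈ shifts D ζ (aeval T (powerLine n s) x)) ∧ G 1 - G 0 = δ

lemma HasIncrement.unique (h : IsShiftCover T x D ζ)
    (hP : ∀ θ, θ ∈ shifts D ζ x ↔ ∃ k : ℤ, θ = k * a)
    (hT : ∀ q : ℂ[X], q ≠ 0 → DenseRange (aeval T q)) {n : ℕ} {δ δ' : ℝ}
    (hδ : HasIncrement T x D ζ n δ) (hδ' : HasIncrement T x D ζ n δ') : δ = δ' := by
  obtain ⟨G, hG, hGu, rfl⟩ := hδ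
  obtain ⟨G', hG', hGu', rfl⟩ := hδ'
  exact h.sub_eq_sub hP hT (powerLine_ne_zero n) hG hG' hGu hGu' 1 0

lemma exists_hasIncrement (h : IsShiftCover T x D ζ) (ha : 0 < a)
    (hP : ∀ θ, θ ∈ shifts D ζ x ↔ ∃ k : ℤ, θ = k * a)
    (hT : ∀ q : ℂ[X], q ≠ 0 → DenseRange (aeval T q)) (n : ℕ) :
    ∃ δ, HasIncrement T x D ζ n δ := by
  obtain ⟨G, hG, hGu⟩ := h.exists_lift ha hP hT (powerLine n) (powerLine_ne_zero n)
    (continuous_aeval_powerLine n)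
  exact ⟨_, G, hG, hGu, rfl⟩

/-- Increments add up, by lifting the triangle with vertices `x`, `T x`, `T ^ (n + 2) x`. -/
lemma HasIncrement.succ (h : IsShiftCover T x D ζ) (ha : 0 < a)
    (hP : ∀ θ, θ ∈ shifts D ζ x ↔ ∃ k : ℤ, θ = k * a)
    (hT : ∀ q : ℂ[X], q ≠ 0 → DenseRange (aeval T q)) {n : ℕ} {δ δ' : ℝ}
    (hδ : HasIncrement T x D ζ 0 δ) (hδ' : HasIncrement T x D ζ n δ') :
    HasIncrement T x D ζ (n + 1) (δ + δ') := by
  let u : ℝ × ℝ → ℂ[X] := fun p ↦ C (1 - (p.1 : ℂ) - p.2) + C (p.1 : ℂ) * Polynomial.X +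
    C (p.2 : ℂ) * Polynomial.X ^ (n + 2)
  have hu : ∀ p, u p ≠ 0 := by
    intro p h0
    have h1 := congrArg (coeff · 0) h0
    have h2 := congrArg (coeff · 1) h0
    have h3 := congrArg (coeff · (n + 2)) h0
    simp [u, coeff_C, coeff_X, coeff_one] at h1 h2 h3
    simp [h2, h3] at h1
  have huc : Continuous fun p ↦ aeval T (u p) x := by
    simp only [u, map_add, map_mul, map_pow, aeval_C, aeval_X, Algebra.algebraMap_eq_smul_one,
      add_apply, mul_apply_eq_comp, smul_apply, one_apply_eq_self]
    fun_prop
  obtain ⟨G, hG, hGu⟩ := h.exists_lift ha hP hT u hu huc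
  have hfst : HasIncrement T x D ζ 0 (G (1, 0) - G (0, 0)) := by
    refine ⟨fun s ↦ G (s, 0), by fun_prop, fun s ↦ ?_, rfl⟩
    simpa [u, powerLine] using hGu (s, 0)
  refine ⟨fun t ↦ G (0, t), by fun_prop, fun t ↦ ?_, ?_⟩
  · simpa [u, powerLine] using hGu (0, t)
  obtain ⟨G', hG', hGu', rfl⟩ := hδ'
  have hdiag := h.sub_eq_sub hP hT (u := fun t ↦ u (1 - t, t)) (fun t ↦ hu _)
    (G := fun t ↦ G (1 - t, t)) (by fun_prop) hG' (fun t ↦ hGu _) (fun t ↦ ?_) 1 0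
  · have := HasIncrement.unique h hP hT hδ hfst
    rw [sub_self, sub_zero] at hdiag
    change G (0, 1) - G (0, 0) = _
    linarith
  · have hX : u (1 - t, t) = Polynomial.X * powerLine n t := by
      simp [u, powerLine]
      ring
    rw [hX, map_mul, aeval_X]
    exact h.shifts_subset_apply _ (hGu' t)

lemma HasIncrement.nsmul (h : IsShiftCover T x D ζ) (ha : 0 < a)
    (hP : ∀ θ, θ ∈ shifts D ζ x ↔ ∃ k : ℤ, θ = k * a)
    (hT : ∀ q : ℂ[X], q ≠ 0 → DenseRange (aeval T q)) {δ : ℝ}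
    (hδ : HasIncrement T x D ζ 0 δ) (n : ℕ) : HasIncrement T x D ζ n ((n + 1) * δ) := by
  induction n with
  | zero => simpa using hδ
  | succ n ih =>
    convert! HasIncrement.succ h ha hP hT hδ ih using 1
    push_cast
    ring

/-- Lifting the strip between the curve `exp (v ℓ) x`, along which the shift is `v θ`, and the
point `T ^ (n + 1) x`. -/
lemma exists_strip_lift (h : IsShiftCover T x D ζ) (ha : 0 < a)
    (hP : ∀ θ, θ ∈ shifts D ζ x ↔ ∃ k : ℤ, θ = k * a)
    (hT : ∀ q : ℂ[X], q ≠ 0 → DenseRange (aeval T q)) (n : ℕ) {ℓ : ℂ} {θ : ℝ}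
    (hℓ : ∀ v : ℝ, v * θ ∈ shifts D ζ (Complex.exp (v * ℓ) • x)) :
    ∃ G : ℝ × ℝ → ℝ, Continuous G ∧
      (∀ s v : ℝ, G (s, v) ∈ shifts D ζ
        ((1 - s : ℂ) • Complex.exp (v * ℓ) • x + (s : ℂ) • (T ^ (n + 1)) x)) ∧
      (∀ v, G (0, v) = G (0, 0) + v * θ) ∧ ∀ v, G (1, v) = G (1, 0) := by
  let u : ℝ × ℝ → ℂ[X] := fun p ↦
    C ((1 - p.1 : ℂ) * Complex.exp (p.2 * ℓ)) + C (p.1 : ℂ) * Polynomial.X ^ (n + 1)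
  have hu : ∀ p, u p ≠ 0 := by
    intro p
    refine C_add_C_mul_X_pow_ne_zero ?_ n
    by_contra! hs
    simp [hs.2] at hs
  have huv : ∀ p, aeval T (u p) x = (1 - p.1 : ℂ) • Complex.exp (p.2 * ℓ) • x +
      (p.1 : ℂ) • (T ^ (n + 1)) x := fun p ↦ by
    rw [aeval_C_add_C_mul_X_pow, mul_smul]
  obtain ⟨G, hG, hGu⟩ := h.exists_lift ha hP hT u hu (by simp only [huv]; fun_prop)
  refine ⟨G, hG, fun s v ↦ huv (s, v) ▸ hGu (s, v), fun v ↦ ?_, fun v ↦ ?_⟩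
  · have := h.sub_eq_sub hP hT (u := fun v ↦ u (0, v)) (fun _ ↦ hu _)
      (G := fun v ↦ G (0, v)) (G' := fun v ↦ v * θ) (by fun_prop) (by fun_prop) (fun _ ↦ hGu _)
      (fun v ↦ by simpa [huv] using hℓ v) v 0
    linarith
  · have := h.sub_eq_sub hP hT (u := fun v ↦ u (1, v)) (fun _ ↦ hu _)
      (G := fun v ↦ G (1, v)) (G' := fun v ↦ G (1, 0)) (by fun_prop) (by fun_prop) (fun _ ↦ hGu _)
      (fun v ↦ by simpa [huv] using hGu (1, 0)) v 0
    linarith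

/-- If `exp ℓ • x` is a limit of the forward orbit of `T x`, some increment equals its shift. -/
lemma exists_hasIncrement_of_mem_closure (h : IsShiftCover T x D ζ) (ha : 0 < a)
    (hP : ∀ θ, θ ∈ shifts D ζ x ↔ ∃ k : ℤ, θ = k * a)
    (hT : ∀ q : ℂ[X], q ≠ 0 → DenseRange (aeval T q)) {ℓ : ℂ} {θ : ℝ}
    (hℓ : ∀ v : ℝ, v * θ ∈ shifts D ζ (Complex.exp (v * ℓ) • x)) (hθ : ∃ k : ℤ, θ = k * a)
    (hcl : Complex.exp ℓ • x ∈ closure (range fun n : ℕ ↦ (T ^ (n + 1)) x)) :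
    ∃ n, HasIncrement T x D ζ n θ := by
  have hinter : ∀ q : ℂ[X], q ≠ 0 → 0 ∈ shifts D ζ (aeval T q x) →
      ∀ τ ∈ shifts D ζ (aeval T q x), ∃ k : ℤ, τ = k * a := fun q hq h0 τ hτ ↦ by
    simpa using (h.mem_shifts_iff hP (hT q hq) h0 τ).mp hτ
  have hexp : aeval T (C (Complex.exp ℓ)) x = Complex.exp ℓ • x := by
    simp [Algebra.algebraMap_eq_smul_one]
  have hexp0 : C (Complex.exp ℓ) ≠ 0 := by simp
  have h0 : (0 : ℝ) ∈ shifts D ζ (Complex.exp ℓ • x) := by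
    obtain ⟨k, hk⟩ := hθ
    have := h.add_mem_shifts ((hP (-θ)).mpr ⟨-k, by push_cast; linarith⟩) (hℓ 1)
    simpa using this
  have hhalf : a / 2 ∉ shifts D ζ (Complex.exp ℓ • x) := by
    intro hmem
    obtain ⟨k, hk⟩ := hinter _ hexp0 (hexp ▸ h0) _ (hexp ▸ hmem)
    have : (1 : ℝ) = 2 * k := by
      have : (1 - 2 * k) * a = 0 := by linarith
      rcases mul_eq_zero.mp this with h | h <;> linarith
    have : (1 : ℤ) = 2 * k := by exact_mod_cast this
    omega
  have hopen : IsOpen {y | a / 2 ∉ shifts D ζ y} :=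
    (h.isClosed.preimage (f := fun y : X ↦ Complex.exp (-((a / 2 : ℝ) * ζ)) • y)
      (by fun_prop)).isOpen_compl
  obtain ⟨ε, hε, hball⟩ := Metric.isOpen_iff.mp hopen _ hhalf
  obtain ⟨_, ⟨n, rfl⟩, hn⟩ := Metric.mem_closure_iff.mp hcl ε hε
  obtain ⟨G, hG, hGu, hG0, hG1⟩ := h.exists_strip_lift ha hP hT n hℓ
  have hseg : ∀ s ∈ uIcc (0 : ℝ) 1, a / 2 ∉ shifts D ζ
      ((1 - s : ℂ) • Complex.exp ((1 : ℝ) * ℓ) • x + (s : ℂ) • (T ^ (n + 1)) x) := by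
    intro s hs
    rw [uIcc_of_le zero_le_one] at hs
    have hc := (convex_ball (Complex.exp ℓ • x) ε) (Metric.mem_ball_self hε)
      (Metric.mem_ball'.mpr hn) (sub_nonneg.mpr hs.2) hs.1 (by ring)
    have := hball hc
    simp only [← Complex.coe_smul] at this
    simpa using this
  obtain ⟨k₀, hk₀⟩ := hinter _ hexp0 (hexp ▸ h0) (G (0, 1)) (by simpa [hexp] using hGu 0 1)
  obtain ⟨k₁, hk₁⟩ := hinter (Polynomial.X ^ (n + 1)) (by simp)
    (by simpa [shifts] using h.pow_mem (n + 1)) (G (1, 1)) (by simpa using hGu 1 1)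
  have hk : k₀ = k₁ := by
    by_contra hne
    obtain ⟨m, hm⟩ : ∃ m : ℤ, (m + 1 / 2) * a ∈ uIcc (G (0, 1)) (G (1, 1)) := by
      rw [hk₀, hk₁]
      rcases lt_or_gt_of_ne hne with hlt | hlt
      · have : (k₀ : ℝ) + 1 ≤ k₁ := by exact_mod_cast hlt
        exact ⟨k₀, mem_uIcc.mpr (Or.inl ⟨by nlinarith, by nlinarith⟩)⟩
      · have : (k₁ : ℝ) + 1 ≤ k₀ := by exact_mod_cast hlt
        exact ⟨k₁, mem_uIcc.mpr (Or.inr ⟨by nlinarith, by nlinarith⟩)⟩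
    obtain ⟨s, hs, hsG⟩ := intermediate_value_uIcc (f := fun s ↦ G (s, 1))
      (by fun_prop) hm
    refine hseg s hs ?_
    have := h.add_mem_shifts ((hP (-m * a)).mpr ⟨-m, by push_cast; ring⟩) (hGu s 1)
    simp only at hsG
    rw [hsG] at this
    convert! this using 1
    ring
  refine ⟨n, fun s ↦ G (s, 0), by fun_prop, fun s ↦ ?_, ?_⟩
  · have := hGu s 0
    rw [powerLine, aeval_C_add_C_mul_X_pow]
    simpa using this
  · have h1 := hG0 1
    have h2 := hG1 1
    rw [hk] at hk₀
    linarith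

/-- The shifts along the unit circle cannot form a discrete group: winding number obstruction. -/
lemma eq_univ_of_circle (h : IsShiftCover T x D Complex.I)
    (hT : ∀ q : ℂ[X], q ≠ 0 → DenseRange (aeval T q)) : D = univ := by
  refine h.eq_univ_or_cyclic.resolve_right ?_
  rintro ⟨a, ha, hP⟩
  obtain ⟨G, hG, hGu, hG0, hG1⟩ := h.exists_strip_lift ha hP hT 0 (ℓ := Complex.I) (θ := 1)
    fun v ↦ by
      rw [shifts, mem_ofPred_eq, smul_smul, ← Complex.exp_add]
      simpa using h.self_mem
  have hper : ∀ s, ∃ k : ℤ, G (s, 2 * Real.pi) - G (s, 0) = k * a := by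
    intro s
    have hne : C (1 - (s : ℂ)) + C (s : ℂ) * Polynomial.X ^ (0 + 1) ≠ 0 := powerLine_ne_zero 0 s
    have h0 : G (s, 0) ∈ shifts D Complex.I
        (aeval T (C (1 - (s : ℂ)) + C (s : ℂ) * Polynomial.X ^ (0 + 1)) x) := by
      rw [aeval_C_add_C_mul_X_pow]
      simpa using hGu s 0
    have h1 : G (s, 2 * Real.pi) ∈ shifts D Complex.I
        (aeval T (C (1 - (s : ℂ)) + C (s : ℂ) * Polynomial.X ^ (0 + 1)) x) := by
      rw [aeval_C_add_C_mul_X_pow]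
      simpa [Complex.exp_two_pi_mul_I] using hGu s (2 * Real.pi)
    exact (h.mem_shifts_iff hP (hT _ hne) h0 _).mp h1
  have := eq_of_forall_eq_int_mul (by fun_prop) hper 0 1
  rw [hG0, hG1] at this
  linarith [Real.pi_pos]

/-- The shifts along the positive axis cannot form a discrete group if they are realized, up to
unimodular factors, by limits of the orbit. -/
lemma eq_univ_of_radial (h : IsShiftCover T x D 1)
    (hT : ∀ q : ℂ[X], q ≠ 0 → DenseRange (aeval T q))
    (hunit : ∀ ξ : ℂ, ‖ξ‖ = 1 → ∀ y ∈ D, ξ • y ∈ D)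
    (hD : ∀ y ∈ D, ∃ ξ : ℂ, ‖ξ‖ = 1 ∧ ξ • y ∈ closure (range fun n : ℕ ↦ (T ^ n) x)) :
    D = univ := by
  refine h.eq_univ_or_cyclic.resolve_right ?_
  rintro ⟨a, ha, hP⟩
  have hx : x ≠ 0 := by
    rintro rfl
    obtain ⟨k, hk⟩ := (hP (a / 2)).mp (by simpa [shifts] using h.self_mem)
    have : (1 - 2 * k) * a = 0 := by linarith
    rcases mul_eq_zero.mp this with h | h
    · have : (1 : ℝ) = 2 * k := by linarith
      have : (1 : ℤ) = 2 * k := by exact_mod_cast this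
      omega
    · exact ha.ne' h
  have hinc : ∀ θ : ℝ, θ ≠ 0 → (∃ k : ℤ, θ = k * a) → ∃ n, HasIncrement T x D 1 n θ := by
    intro θ hθ0 hθ
    have hmem : -θ ∈ shifts D 1 x := by
      obtain ⟨k, hk⟩ := hθ
      exact (hP _).mpr ⟨-k, by push_cast; linarith⟩
    obtain ⟨ξ, hξ, hcl⟩ := hD _ hmem
    set γ : ℂ := ξ * Complex.exp (-((-θ : ℝ) * 1)) with hγ
    rw [smul_smul, ← hγ] at hcl
    have hnorm : ‖γ‖ = Real.exp θ := by
      rw [hγ, norm_mul, hξ, one_mul, Complex.norm_exp]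
      simp
    have hγ0 : γ ≠ 0 := by
      rw [← norm_pos_iff, hnorm]
      exact Real.exp_pos θ
    refine h.exists_hasIncrement_of_mem_closure ha hP hT (ℓ := Complex.log γ) (fun v ↦ ?_) hθ ?_
    · rw [shifts, mem_ofPred_eq, smul_smul, ← Complex.exp_add]
      refine hunit _ ?_ _ h.self_mem
      rw [Complex.norm_exp]
      simp [Complex.log_re, hnorm]
    · rw [Complex.exp_log hγ0]
      refine smul_mem_closure_range_pow_succ hx (fun h1 ↦ ?_) hcl
      rw [h1, norm_one, eq_comm, Real.exp_eq_one_iff] at hnorm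
      exact hθ0 hnorm
  obtain ⟨n, hn⟩ := hinc a ha.ne' ⟨1, by simp⟩
  obtain ⟨m, hm⟩ := hinc (-a) (by simpa using ha.ne') ⟨-1, by simp⟩
  obtain ⟨δ, hδ⟩ := h.exists_hasIncrement ha hP hT 0
  have h1 := HasIncrement.unique h hP hT (HasIncrement.nsmul h ha hP hT hδ n) hn
  have h2 := HasIncrement.unique h hP hT (HasIncrement.nsmul h ha hP hT hδ m) hm
  rcases le_total 0 δ with h3 | h3
  · have : 0 ≤ (m + 1) * δ := by positivity
    linarith
  · have : (n + 1) * δ ≤ 0 := mul_nonpos_of_nonneg_of_nonpos (by positivity) h3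
    linarith

end IsShiftCover

lemma IsShiftCover.of_closure_scaledOrbit {ζ : ℂ}
    (hcover : ∃ L : ℝ, ∀ y, ∃ θ ∈ Icc (-L) L, θ ∈ shifts (closure (scaledOrbit Γ T x)) ζ y) :
    IsShiftCover T x (closure (scaledOrbit Γ T x)) ζ where
  isClosed := isClosed_closure
  self_mem := subset_closure self_mem_scaledOrbit
  apply_mem := subset_closure ⟨1, Γ.one_mem, 1, by simp⟩
  mapsTo _ hq := mapsTo_aeval_closure isClosed_closure
    (fun _ hγ n _ hy ↦ smul_pow_mem_closure hγ n hy) hq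
  cover := hcover

/-- The vectors having a multiple in `D` with ratio of modulus between `r⁻¹` and `r`. -/
def annularHull (r : ℝ) (D : Set X) : Set X := {y | ∃ k ∈ {k : ℂ | r⁻¹ ≤ ‖k‖ ∧ ‖k‖ ≤ r}, k • y ∈ D}

lemma isClosed_annularHull (r : ℝ) {D : Set X} (hD : IsClosed D) : IsClosed (annularHull r D) := by
  have hK : IsCompact {k : ℂ | r⁻¹ ≤ ‖k‖ ∧ ‖k‖ ≤ r} := by
    refine (isCompact_closedBall (0 : ℂ) r).of_isClosed_subset ?_ fun k hk ↦ by simpa using hk.2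
    exact (isClosed_le continuous_const continuous_norm).inter
      (isClosed_le continuous_norm continuous_const)
  exact isClosed_exists_mem hK (hD.preimage (f := fun p : ℂ × X ↦ p.1 • p.2) (by fun_prop))

/-- If every vector has a multiple of bounded ratio in the orbit closure of `x`, then `x` is
hypercyclic, provided nonzero polynomials in `T` have dense range. -/
lemma closure_orbit_eq_univ (hT : ∀ q : ℂ[X], q ≠ 0 → DenseRange (aeval T q)) {r : ℝ} (hr : 0 < r)
    (h : ∀ y, y ∈ annularHull r (closure (scaledOrbit ⊥ T x))) :
    closure (scaledOrbit ⊥ T x) = univ := by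
  set E : Set X := {y | ∃ ξ ∈ Metric.sphere (0 : ℂ) 1, ξ • y ∈ closure (scaledOrbit ⊥ T x)}
    with hE
  have hEcl : IsClosed E := isClosed_exists_mem (isCompact_sphere (0 : ℂ) 1)
    (isClosed_closure.preimage (f := fun p : ℂ × X ↦ p.1 • p.2) (by fun_prop))
  have hsub : closure (scaledOrbit (Submonoid.unitSphere ℂ) T x) ⊆ E := by
    refine closure_minimal ?_ hEcl
    rintro _ ⟨γ, hγ, n, rfl⟩
    have hγ1 : ‖γ‖ = 1 := mem_sphere_zero_iff_norm.mp hγ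
    have hγ0 : γ ≠ 0 := by
      rw [← norm_pos_iff, hγ1]
      exact one_pos
    refine ⟨γ⁻¹, by simp [hγ1], ?_⟩
    rw [inv_smul_smul₀ hγ0]
    exact subset_closure ⟨1, Submonoid.one_mem _, n, by simp⟩
  have hsup : closure (scaledOrbit ⊥ T x) ⊆ closure (scaledOrbit (Submonoid.unitSphere ℂ) T x) :=
    closure_mono (scaledOrbit_mono bot_le)
  have hunit : ∀ ξ : ℂ, ‖ξ‖ = 1 → ∀ y ∈ closure (scaledOrbit (Submonoid.unitSphere ℂ) T x),
      ξ • y ∈ closure (scaledOrbit (Submonoid.unitSphere ℂ) T x) := fun ξ hξ y hy ↦ by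
    simpa using smul_pow_mem_closure (γ := ξ) (mem_sphere_zero_iff_norm.mpr hξ) 0 hy
  have hrad : IsShiftCover T x (closure (scaledOrbit (Submonoid.unitSphere ℂ) T x)) 1 := by
    refine .of_closure_scaledOrbit ⟨Real.log r, fun y ↦ ?_⟩
    obtain ⟨k, ⟨hk1, hk2⟩, hk⟩ := h y
    have hk0 : 0 < ‖k‖ := (inv_pos.mpr hr).trans_le hk1
    have hkne : (‖k‖ : ℂ) ≠ 0 := by exact_mod_cast hk0.ne'
    refine ⟨-Real.log ‖k‖, ⟨neg_le_neg (Real.log_le_log hk0 hk2), ?_⟩, ?_⟩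
    · have := Real.log_le_log (inv_pos.mpr hr) hk1
      rw [Real.log_inv] at this
      linarith
    · have := hunit (‖k‖ / k) (by simp [hk0.ne']) _ (hsup hk)
      rw [smul_smul, div_mul_cancel₀ _ (norm_pos_iff.mp hk0)] at this
      rw [shifts, mem_ofPred_eq]
      have hexp : Complex.exp (-(((-Real.log ‖k‖ : ℝ) : ℂ) * 1)) = ‖k‖ := by
        rw [mul_one, ← Complex.ofReal_neg, neg_neg, ← Complex.ofReal_exp, Real.exp_log hk0]
      rwa [hexp]
  have huniv := hrad.eq_univ_of_radial hT hunit fun y hy ↦ by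
    obtain ⟨ξ, hξ, hy⟩ := hsub hy
    exact ⟨ξ, by simpa using hξ, by rwa [← scaledOrbit_bot]⟩
  have hcirc : IsShiftCover T x (closure (scaledOrbit ⊥ T x)) Complex.I := by
    refine .of_closure_scaledOrbit ⟨Real.pi, fun y ↦ ?_⟩
    obtain ⟨ξ, hξ, hy⟩ := hsub (huniv ▸ mem_univ y)
    have hξ1 : ‖ξ‖ = 1 := by simpa using hξ
    have hξ0 : ξ ≠ 0 := by
      rw [← norm_pos_iff, hξ1]
      exact one_pos
    have harg := Complex.abs_arg_le_pi ξ
    refine ⟨-ξ.arg, ⟨by linarith [(abs_le.mp harg).2], by linarith [(abs_le.mp harg).1]⟩, ?_⟩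
    have hexp : Complex.exp (-(((-ξ.arg : ℝ) : ℂ) * Complex.I)) = ξ := by
      have := Complex.norm_mul_exp_arg_mul_I ξ
      rw [hξ1] at this
      simpa using this
    rw [shifts, mem_ofPred_eq]
    rwa [hexp]
  exact hcirc.eq_univ_of_circle hT

lemma smul_mem_closure_orbit_of_smul_mem {y : X} {γ : ℂ} (h : γ • x ∈ closure (scaledOrbit ⊥ T y))
    {z : X} (hz : z ∈ closure (scaledOrbit ⊥ T x)) : γ • z ∈ closure (scaledOrbit ⊥ T y) := by
  simpa [Algebra.algebraMap_eq_smul_one] using mapsTo_aeval_closure (q := C γ) isClosed_closure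
    (fun δ hδ n w hw ↦ smul_pow_mem_closure hδ n hw)
    (by simpa [Algebra.algebraMap_eq_smul_one] using h) hz

lemma annularHull_mono {r s : ℝ} (hr : 0 < r) (hrs : r ≤ s) (D : Set X) :
    annularHull r D ⊆ annularHull s D := by
  rintro y ⟨k, ⟨hk1, hk2⟩, hk⟩
  exact ⟨k, ⟨(inv_anti₀ hr hrs).trans hk1, hk2.trans hrs⟩, hk⟩

/-- A finite family of orbit closures covering the space up to bounded ratios can be thinned out
so that no remaining vector has a nonzero multiple in the orbit closure of another one. -/
lemma exists_independent_cover (s : Finset X) : ∀ r : ℝ, 0 < r →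
    (∀ z, ∃ x ∈ s, z ∈ annularHull r (closure (scaledOrbit ⊥ T x))) →
    ∃ t ⊆ s, ∃ r : ℝ, 0 < r ∧ (∀ z, ∃ x ∈ t, z ∈ annularHull r (closure (scaledOrbit ⊥ T x))) ∧
      ∀ x ∈ t, ∀ y ∈ t, ∀ γ : ℂ, γ ≠ 0 → γ • x ∈ closure (scaledOrbit ⊥ T y) → x = y := by
  classical
  induction s using Finset.strongInduction with
  | H s ih =>
    intro r hr hs
    by_cases hind : ∀ x ∈ s, ∀ y ∈ s, ∀ γ : ℂ, γ ≠ 0 →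
        γ • x ∈ closure (scaledOrbit ⊥ T y) → x = y
    · exact ⟨s, subset_rfl, r, hr, hs, hind⟩
    push Not at hind
    obtain ⟨x, hx, y, hy, γ, hγ, hγx, hxy⟩ := hind
    set m : ℝ := max 1 (max ‖γ‖ ‖γ‖⁻¹) with hm
    have hm1 : 1 ≤ m := le_max_left _ _
    have hm2 : ‖γ‖ ≤ m := (le_max_left _ _).trans (le_max_right _ _)
    have hm3 : m⁻¹ ≤ ‖γ‖ := inv_le_of_inv_le₀ (norm_pos_iff.mpr hγ)
      ((le_max_right _ _).trans (le_max_right _ _))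
    have hm0 : 0 < m := one_pos.trans_le hm1
    obtain ⟨t, ht, h⟩ := ih (s.erase x) (Finset.erase_ssubset hx) (m * r) (by positivity) fun z ↦ by
      obtain ⟨w, hw, hz⟩ := hs z
      by_cases hwx : w = x
      · subst hwx
        obtain ⟨k, ⟨hk1, hk2⟩, hk⟩ := hz
        refine ⟨y, Finset.mem_erase.mpr ⟨hxy.symm, hy⟩, γ * k, ⟨?_, ?_⟩, ?_⟩
        · rw [norm_mul, mul_inv]
          gcongr
        · rw [norm_mul]
          gcongr
        · rw [mul_smul]
          exact smul_mem_closure_orbit_of_smul_mem hγx hk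
      · exact ⟨w, Finset.mem_erase.mpr ⟨hwx, hw⟩,
          annularHull_mono hr (le_mul_of_one_le_left hr.le hm1) _ hz⟩
    exact ⟨t, ht.trans (Finset.erase_subset _ _), h⟩

lemma annularHull_subset_closure_projectiveOrbit {r : ℝ} (hr : 0 < r) :
    annularHull r (closure (scaledOrbit ⊥ T x)) ⊆
      closure (scaledOrbit (nonZeroDivisors ℂ) T x) := by
  rintro y ⟨k, ⟨hk1, -⟩, hk⟩
  have hk0 : k ≠ 0 := norm_pos_iff.mp ((inv_pos.mpr hr).trans_le hk1)
  have := smul_pow_mem_closure (Γ := nonZeroDivisors ℂ) (T := T) (x := x) (γ := k⁻¹)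
    (by simpa using hk0) 0 (closure_mono (scaledOrbit_mono bot_le) hk)
  simpa [hk0] using this

/-- If the orbit closure of `x` meets the line of `x` at bounded ratios and is somewhere dense up to
bounded ratios, then `x` is hypercyclic. -/
lemma closure_orbit_eq_univ_of_interior (hT : ∀ q : ℂ[X], q ≠ 0 → DenseRange (aeval T q)) {r : ℝ}
    (hr : 0 < r) (hx : ∀ c : ℂ, c ≠ 0 → c • x ∈ annularHull r (closure (scaledOrbit ⊥ T x)))
    (hinter : (interior (annularHull r (closure (scaledOrbit ⊥ T x)))).Nonempty) :
    closure (scaledOrbit ⊥ T x) = univ := by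
  have hrec : x ∈ closure (scaledOrbit (nonZeroDivisors ℂ) T (T x)) := by
    rcases eq_or_ne x 0 with rfl | hx0
    · exact subset_closure ⟨1, Submonoid.one_mem _, 0, by simp⟩
    obtain ⟨k, ⟨hk1, -⟩, hk⟩ := hx (2 * r) (by exact_mod_cast (by positivity : 2 * r ≠ 0))
    rw [smul_smul, scaledOrbit_bot] at hk
    have hnorm : 2 ≤ ‖k * (2 * r)‖ := by
      rw [norm_mul, norm_mul, Complex.norm_real, Complex.norm_two, Real.norm_of_nonneg hr.le]
      calc 2 = r⁻¹ * (2 * r) := by field_simp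
        _ ≤ _ := by gcongr
    set γ := k * (2 * r)
    have hγ1 : γ ≠ 1 := by
      intro h
      rw [h, norm_one] at hnorm
      norm_num at hnorm
    have hγ0 : γ ≠ 0 := norm_pos_iff.mp (two_pos.trans_le hnorm)
    have := map_mem_closure (f := fun y ↦ γ⁻¹ • y) (by fun_prop)
      (smul_mem_closure_range_pow_succ hx0 hγ1 hk)
      (t := scaledOrbit (nonZeroDivisors ℂ) T (T x)) (by
        rintro _ ⟨n, rfl⟩
        exact ⟨γ⁻¹, by simpa using hγ0, n, by simp [pow_succ]⟩)
    simpa [hγ0] using this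
  have hproj := closure_projectiveOrbit_eq_univ hT hrec
    (hinter.mono (interior_mono (annularHull_subset_closure_projectiveOrbit hr)))
  refine closure_orbit_eq_univ hT hr fun y ↦ ?_
  refine closure_minimal ?_ (isClosed_annularHull r isClosed_closure) (hproj ▸ mem_univ y)
  rintro _ ⟨c, hc, n, rfl⟩
  obtain ⟨k, hk, hkx⟩ := hx c (by simpa using hc)
  refine ⟨k, hk, ?_⟩
  have := smul_pow_mem_closure (Submonoid.one_mem ⊥) n hkx
  simpa using this

/-- A dense union of finitely many annular orbits forbids eigenvectors of the transpose. -/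
lemma eq_zero_of_forall_apply_eq_mul {ι : Type*} [Finite ι] {b : ℝ} {x : ι → X}
    (h : Dense {y : X | ∃ γ : ℂ, 1 ≤ ‖γ‖ ∧ ‖γ‖ ≤ b ∧ ∃ n : ℕ, ∃ i, y = γ • (T ^ n) (x i)})
    (φ : X →L[ℂ] ℂ) (a : ℂ) (hφ : ∀ y, φ (T y) = a * φ y) : φ = 0 := by
  have := Fintype.ofFinite ι
  by_contra hne
  obtain ⟨v, hv⟩ : ∃ v, φ v ≠ 0 := by
    by_contra! hall
    exact hne (ContinuousLinearMap.ext hall)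
  have hsurj : Function.Surjective φ := fun c ↦ ⟨(c / φ v) • v, by simp [hv]⟩
  have hpow : ∀ n y, φ ((T ^ n) y) = a ^ n * φ y := by
    intro n y
    induction n with
    | zero => simp
    | succ n ih => rw [pow_succ', mul_apply_eq_comp, hφ, ih, pow_succ', mul_assoc]
  have hd := hsurj.denseRange.dense_image φ.continuous h
  obtain ⟨M, hM⟩ := (finite_range fun i ↦ ‖φ (x i)‖).bddAbove
  rcases le_total ‖a‖ 1 with ha | ha
  · obtain ⟨_, ⟨_, ⟨γ, -, hγ, n, i, rfl⟩, rfl⟩, hz⟩ := hd.exists_mem_open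
      (isOpen_lt continuous_const continuous_norm : IsOpen {z : ℂ | b * M < ‖z‖})
      ⟨((|b * M| + 1 : ℝ) : ℂ), by
        rw [mem_ofPred_eq, Complex.norm_real, Real.norm_of_nonneg (by positivity)]
        linarith [le_abs_self (b * M)]⟩
    rw [mem_ofPred_eq, map_smul, hpow, smul_eq_mul, norm_mul, norm_mul, norm_pow] at hz
    have h1 : ‖φ (x i)‖ ≤ M := hM ⟨i, rfl⟩
    have h2 : ‖a‖ ^ n ≤ 1 := pow_le_one₀ (norm_nonneg _) ha
    have h3 : ‖a‖ ^ n * ‖φ (x i)‖ ≤ M := by nlinarith [norm_nonneg (φ (x i))]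
    have h4 : 0 ≤ ‖a‖ ^ n * ‖φ (x i)‖ := by positivity
    nlinarith [norm_nonneg γ]
  · obtain ⟨m, hm0, hm⟩ : ∃ m > 0, ∀ i, φ (x i) ≠ 0 → m ≤ ‖φ (x i)‖ := by
      have : ∀ i, ∀ᶠ m : ℝ in 𝓝[>] 0, φ (x i) ≠ 0 → m ≤ ‖φ (x i)‖ := by
        intro i
        by_cases hi : φ (x i) = 0
        · simp [hi]
        filter_upwards [nhdsWithin_le_nhds (eventually_le_nhds (norm_pos_iff.mpr hi))] with m hm _
          using hm
      obtain ⟨m, hm, hm0⟩ := ((eventually_all.mpr this).and self_mem_nhdsWithin).exists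
      exact ⟨m, hm0, hm⟩
    obtain ⟨_, ⟨_, ⟨γ, hγ, -, n, i, rfl⟩, rfl⟩, hz⟩ := hd.exists_mem_open
      ((isOpen_lt continuous_const continuous_norm).inter
        (isOpen_lt continuous_norm continuous_const) : IsOpen ({z : ℂ | 0 < ‖z‖} ∩ {z | ‖z‖ < m}))
      ⟨((m / 2 : ℝ) : ℂ), by
        simp only [mem_inter_iff, mem_ofPred_eq, Complex.norm_real]
        rw [Real.norm_of_nonneg (by positivity)]
        exact ⟨by positivity, by linarith⟩⟩
    obtain ⟨hz0, hz⟩ := hz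
    rw [mem_ofPred_eq, map_smul, hpow, smul_eq_mul, norm_mul, norm_mul, norm_pow] at hz0 hz
    have h1 : m ≤ ‖φ (x i)‖ := hm i fun h0 ↦ by simp [h0] at hz0
    have h2 : 1 ≤ ‖a‖ ^ n := one_le_pow₀ ha
    have h3 : m ≤ ‖a‖ ^ n * ‖φ (x i)‖ := by nlinarith
    nlinarith

/-- Among finitely many vectors with dense union of annular orbits there is a hypercyclic one. -/
lemma exists_closure_orbit_eq_univ [CompleteSpace X] {ι : Type*} [Finite ι] {b : ℝ} (hb : 1 ≤ b)
    {x : ι → X}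
    (h : Dense {y : X | ∃ γ : ℂ, 1 ≤ ‖γ‖ ∧ ‖γ‖ ≤ b ∧ ∃ n : ℕ, ∃ i, y = γ • (T ^ n) (x i)}) :
    ∃ i, closure (scaledOrbit ⊥ T (x i)) = univ := by
  classical
  have := Fintype.ofFinite ι
  have hb0 : 0 < b := one_pos.trans_le hb
  have hT : ∀ q : ℂ[X], q ≠ 0 → DenseRange (aeval T q) := fun q hq ↦
    denseRange_aeval (eq_zero_of_forall_apply_eq_mul h) hq
  obtain ⟨t, ht, r, hr, hcov, hind⟩ := exists_independent_cover (T := T) (Finset.univ.image x) b hb0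
    fun z ↦ by
      have hcl : IsClosed (⋃ i, annularHull b (closure (scaledOrbit ⊥ T (x i)))) :=
        isClosed_iUnion_of_finite fun i ↦ isClosed_annularHull b isClosed_closure
      have hz := closure_minimal (t := ⋃ i, annularHull b (closure (scaledOrbit ⊥ T (x i)))) (by
        rintro _ ⟨γ, hγ1, hγ2, n, i, rfl⟩
        have hγ0 : 0 < ‖γ‖ := one_pos.trans_le hγ1
        refine mem_iUnion.mpr ⟨i, γ⁻¹, ⟨?_, ?_⟩, ?_⟩
        · rw [norm_inv]
          exact inv_anti₀ hγ0 hγ2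
        · rw [norm_inv]
          exact (inv_le_one_of_one_le₀ hγ1).trans hb
        · rw [inv_smul_smul₀ (norm_pos_iff.mp hγ0)]
          exact subset_closure ⟨1, Submonoid.one_mem _, n, by simp⟩) hcl (h z)
      obtain ⟨i, hi⟩ := mem_iUnion.mp hz
      exact ⟨x i, by simp, hi⟩
  obtain ⟨⟨y, hy⟩, hinter⟩ := nonempty_interior_of_iUnion_of_closed
    (f := fun y : t ↦ annularHull r (closure (scaledOrbit ⊥ T (y : X))))
    (fun y ↦ isClosed_annularHull r isClosed_closure) (eq_univ_of_forall fun z ↦ by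
      obtain ⟨y, hy, hz⟩ := hcov z
      exact mem_iUnion.mpr ⟨⟨y, hy⟩, hz⟩)
  obtain ⟨i, -, rfl⟩ := Finset.mem_image.mp (ht hy)
  refine ⟨i, closure_orbit_eq_univ_of_interior hT hr (fun c hc ↦ ?_) hinter⟩
  obtain ⟨w, hw, k, hk, hkc⟩ := hcov (c • x i)
  have hk0 : k ≠ 0 := norm_pos_iff.mp ((inv_pos.mpr hr).trans_le hk.1)
  have heq := hind _ hy w hw (k * c) (mul_ne_zero hk0 hc) (by rwa [mul_smul])
  exact ⟨k, hk, by rwa [← heq] at hkc⟩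

end HypercyclicOrbit

/-- If the union of the orbits of the annuli `[1,b]𝕋 xᵢ`, `1 ≤ i ≤ N`, is dense in a
separable complex Banach space, then some `xᵢ` is hypercyclic for `T`. -/
theorem stmt_2 {X : Type*} [NormedAddCommGroup X] [NormedSpace ℂ X] [CompleteSpace X]
    [TopologicalSpace.SeparableSpace X]
    (T : X →L[ℂ] X) (b : ℝ) (hb : 1 ≤ b) (N : ℕ) (x : Fin N → X)
    (h : Dense {y : X | ∃ γ : ℂ, 1 ≤ ‖γ‖ ∧ ‖γ‖ ≤ b ∧ ∃ n : ℕ, ∃ i : Fin N,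
        y = γ • (T ^ n) (x i)}) :
    ∃ i : Fin N, Dense (Set.range fun n : ℕ => (T ^ n) (x i)) := by
  obtain ⟨i, hi⟩ := HypercyclicOrbit.exists_closure_orbit_eq_univ hb h
  exact ⟨i, by rwa [dense_iff_closure_eq, ← HypercyclicOrbit.scaledOrbit_bot]⟩
end

section
/- Let H be a separable Hilbert space and C a finite-dimensional subset of H which is a hypercyclic subset. Then every C-hypercyclic operator T on H admits a hypercyclic vector belonging to C. -/
open Filter Topology

lemma not_dense_orbit_of_dual_eigenvector {H : Type*} [NormedAddCommGroup H] [NormedSpace ℂ H]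
    {T : H →L[ℂ] H} {g : H →L[ℂ] ℂ} {μ : ℂ} (hg : g ≠ 0) (hT : ∀ x, g (T x) = μ * g x) (x : H) :
    ¬ Dense (Set.range fun n : ℕ => (T ^ n) x) := by
  intro hd
  have hsurj : Function.Surjective g := by
    refine LinearMap.surjective (f := g.toLinearMap) fun h => hg ?_
    ext y
    simpa using congrArg (fun f => f y) h
  have hpow (n : ℕ) : g ((T ^ n) x) = μ ^ n * g x := by
    induction n with
    | zero => simp
    | succ n ih =>
      rw [pow_succ', mul_apply_eq_comp, hT, ih]
      ring
  have hdense : Dense (Set.range fun n : ℕ => μ ^ n * g x) := by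
    have := hsurj.denseRange.dense_image g.continuous hd
    rwa [← Set.range_comp, show (g ∘ fun n : ℕ => (T ^ n) x) = fun n : ℕ => μ ^ n * g x from
      funext hpow] at this
  rcases le_or_gt ‖μ‖ 1 with h | h
  · have hsub : (Set.range fun n : ℕ => μ ^ n * g x) ⊆ Metric.closedBall 0 ‖g x‖ := by
      rintro _ ⟨n, rfl⟩
      simpa using mul_le_of_le_one_left (norm_nonneg (g x)) (pow_le_one₀ (norm_nonneg μ) h)
    have hmem := closure_minimal hsub Metric.isClosed_closedBall (hdense ((‖g x‖ + 1 : ℝ) : ℂ))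
    rw [mem_closedBall_zero_iff, Complex.norm_real, Real.norm_of_nonneg (by positivity)] at hmem
    linarith
  · rcases eq_or_ne (g x) 0 with h0 | h0
    · have hsub : (Set.range fun n : ℕ => μ ^ n * g x) ⊆ {0} := by
        rintro _ ⟨n, rfl⟩
        simp [h0]
      have hmem := closure_minimal hsub isClosed_singleton (hdense 1)
      simp at hmem
    · obtain ⟨_, hy, n, rfl⟩ := hdense.inter_open_nonempty _ Metric.isOpen_ball
        ⟨0, Metric.mem_ball_self (norm_pos_iff.mpr h0)⟩
      rw [mem_ball_zero_iff, norm_mul, norm_pow] at hy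
      nlinarith [one_le_pow₀ h.le (n := n), norm_nonneg (g x)]

lemma not_finiteDimensional_of_dense_orbit {H : Type*} [NormedAddCommGroup H] [NormedSpace ℂ H]
    [Nontrivial H] {T : H →L[ℂ] H} {x : H} (hx : Dense (Set.range fun n : ℕ => (T ^ n) x)) :
    ¬ FiniteDimensional ℂ H := by
  intro _
  obtain ⟨μ, hμ⟩ := Module.End.exists_eigenvalue (K := ℂ) (V := Module.Dual ℂ H)
    T.toLinearMap.dualMap
  obtain ⟨g, hg⟩ := hμ.exists_hasEigenvector
  refine not_dense_orbit_of_dual_eigenvector (g := LinearMap.toContinuousLinearMap g) (μ := μ)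
    ?_ (fun y => ?_) x hx
  · simpa using hg.2
  · simpa using congrArg (fun f => f y) hg.apply_eq_smul

lemma Orthonormal.countable {M ι : Type*} [NormedAddCommGroup M] [InnerProductSpace ℂ M]
    [TopologicalSpace.SeparableSpace M] {e : ι → M} (he : Orthonormal ℂ e) : Countable ι := by
  refine Pairwise.countable_of_isOpen_disjoint (s := fun i => Metric.ball (e i) (1 / 2))
    (fun i j hij => Metric.ball_disjoint_ball ?_) (fun _ => Metric.isOpen_ball)
    fun i => ⟨e i, Metric.mem_ball_self (by norm_num)⟩
  have h2 : ‖e i - e j‖ ^ 2 = 2 := by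
    rw [@norm_sub_sq ℂ, he.1, he.1, he.2 hij]
    norm_num
  rw [dist_eq_norm]
  nlinarith [norm_nonneg (e i - e j)]

lemma exists_scaled_backward_shift {M : Type*} [NormedAddCommGroup M] [InnerProductSpace ℂ M]
    [CompleteSpace M] [TopologicalSpace.SeparableSpace M] (hM : ¬ FiniteDimensional ℂ M)
    (N : Submodule ℂ M) [FiniteDimensional ℂ N] :
    ∃ S F : M →L[ℂ] M, (∀ x, S (F x) = x) ∧ (∀ x, ‖F x‖ ≤ 3⁻¹ * ‖x‖) ∧ (∀ x ∈ N, S x = 0) ∧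
      Dense {x | ∃ n₀, ∀ n ≥ n₀, (S ^ n) x = 0} := by
  classical
  let o := stdOrthonormalBasis ℂ N
  have ho : Orthonormal ℂ (fun i => (o i : M)) :=
    o.orthonormal.comp_linearIsometry N.subtypeₗᵢ
  obtain ⟨w, b, hsub, hb⟩ := ho.toSubtypeRange.exists_hilbertBasis_extension
  have hcount : Countable w := b.orthonormal.countable
  have hinf : Infinite w := by
    by_contra h
    rw [not_infinite_iff_finite] at h
    have := Fintype.ofFinite w
    exact hM b.toOrthonormalBasis.toBasis.finiteDimensional_of_finite
  obtain ⟨e⟩ : Nonempty (w ≃ ℕ) := nonempty_equiv_of_countable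
  obtain ⟨m, hm1, hm⟩ : ∃ m : ℕ, 1 ≤ m ∧ ∀ i, ∃ j < m, b (e.symm j) = o i := by
    let f (i) : ℕ := e ⟨o i, hsub ⟨i, rfl⟩⟩
    obtain ⟨B, hB⟩ := (Set.finite_range f).bddAbove
    refine ⟨B + 1, by omega, fun i => ⟨f i, Nat.lt_succ_of_le (hB ⟨i, rfl⟩), ?_⟩⟩
    simp [f, hb]
  let c (i : ℕ) : M := b (e.symm i)
  have hc : Orthonormal ℂ c := b.orthonormal.comp _ e.symm.injective
  have hcspan : Dense (Submodule.span ℂ (Set.range c) : Set M) := by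
    rw [show Set.range c = Set.range b from e.symm.surjective.range_comp b]
    exact Submodule.dense_iff_topologicalClosure_eq_top.mpr b.dense_span
  have hshift : Orthonormal ℂ (fun i : w => c (e i + m)) :=
    hc.comp (fun i : w => e i + m) fun i j h => e.injective (by simpa using h)
  let V : M →ₗᵢ[ℂ] M :=
    hshift.orthogonalFamily.linearIsometry.comp b.repr.toLinearIsometry
  have hV (i : ℕ) : V (c i) = c (i + m) := by
    change hshift.orthogonalFamily.linearIsometry (b.repr (b (e.symm i))) = _
    rw [b.repr_self, OrthogonalFamily.linearIsometry_apply_single]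
    simp
  let A : M →L[ℂ] M := ContinuousLinearMap.adjoint V.toContinuousLinearMap
  have hAV (x : M) : A (V x) = x := by
    refine ext_inner_left ℂ fun y => ?_
    rw [ContinuousLinearMap.adjoint_inner_right]
    exact V.inner_map_map y x
  have hA0 (i : ℕ) (hi : i < m) : A (c i) = 0 := by
    refine hcspan.eq_zero_of_inner_right (𝕜 := ℂ) fun y hy => ?_
    rw [ContinuousLinearMap.adjoint_inner_right]
    induction hy using Submodule.span_induction with
    | mem y hy =>
      obtain ⟨j, rfl⟩ := hy
      change inner ℂ (V (c j)) (c i) = 0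
      rw [hV, hc.2 (by omega)]
    | zero => simp
    | add x y _ _ hx hy => rw [map_add, inner_add_left, hx, hy, add_zero]
    | smul a x _ hx => rw [map_smul, inner_smul_left, hx, mul_zero]
  have hA1 (i : ℕ) : A (c (i + m)) = c i := by rw [← hV, hAV]
  refine ⟨(3 : ℂ) • A, (3⁻¹ : ℂ) • V.toContinuousLinearMap, fun x => ?_, fun x => ?_,
    fun x hx => ?_, ?_⟩
  · simp [hAV]
  · simp [norm_smul]
  · have hspan : N ≤ LinearMap.ker A.toLinearMap := by
      intro y hy
      rw [LinearMap.mem_ker, ← Submodule.coe_mk y hy, ← o.sum_repr ⟨y, hy⟩]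
      simp only [Submodule.coe_sum, Submodule.coe_smul, map_sum, map_smul]
      refine Finset.sum_eq_zero fun i _ => ?_
      obtain ⟨j, hj, hji⟩ := hm i
      rw [← hji]
      exact (congrArg _ (hA0 j hj)).trans (smul_zero _)
    simpa using hspan hx
  · refine hcspan.mono fun x hx => ?_
    induction hx using Submodule.span_induction with
    | mem x hx =>
      obtain ⟨i, rfl⟩ := hx
      induction i using Nat.strong_induction_on with
      | _ i ih =>
        rcases lt_or_ge i m with h | h
        · refine ⟨1, fun n hn => ?_⟩
          obtain ⟨k, rfl⟩ := Nat.exists_eq_add_of_le' hn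
          rw [pow_succ, mul_apply_eq_comp, smul_apply, hA0 i h, smul_zero, map_zero]
        · obtain ⟨j, rfl⟩ := Nat.exists_eq_add_of_le' h
          obtain ⟨n₀, hn₀⟩ := ih j (by omega)
          refine ⟨n₀ + 1, fun n hn => ?_⟩
          obtain ⟨k, rfl⟩ := Nat.exists_eq_add_of_le' (show 1 ≤ n by omega)
          rw [pow_succ, mul_apply_eq_comp, smul_apply, hA1,
            map_smul, hn₀ k (by omega), smul_zero]
    | zero => exact ⟨0, fun n _ => map_zero _⟩
    | add x y _ _ hx hy =>
      obtain ⟨n₁, h₁⟩ := hx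
      obtain ⟨n₂, h₂⟩ := hy
      exact ⟨max n₁ n₂, fun n hn => by
        rw [map_add, h₁ n (le_of_max_le_left hn), h₂ n (le_of_max_le_right hn), add_zero]⟩
    | smul a x _ hx =>
      obtain ⟨n₀, h⟩ := hx
      exact ⟨n₀, fun n hn => by rw [map_smul, h n hn, smul_zero]⟩

lemma exists_tendsto_pow_eq {z : ℕ → ℂ} (hz : ∀ k, z k ≠ 0) {μ v : ℂ} (hv : v ≠ 0)
    (hlog : Tendsto (fun k => Real.log ‖z k‖ / Real.log ‖μ‖) atTop atBot) :
    ∃ (n : ℕ → ℕ) (ν : ℕ → ℂ), Tendsto n atTop atTop ∧ Tendsto ν atTop (𝓝 μ) ∧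
      ∀ᶠ k in atTop, z k * ν k ^ n k = v := by
  have hμlog : Real.log ‖μ‖ ≠ 0 := by
    intro h
    simp only [h, div_zero] at hlog
    exact not_tendsto_const_atBot _ _ hlog
  have hμ : μ ≠ 0 := by
    rintro rfl
    simp at hμlog
  set s := Complex.log μ with hs
  have hsre : s.re = Real.log ‖μ‖ := Complex.log_re μ
  let L (k : ℕ) : ℂ := Complex.log (v / z k)
  have hLre (k : ℕ) : (L k).re = Real.log ‖v‖ - Real.log ‖z k‖ := by
    rw [Complex.log_re, norm_div, Real.log_div (norm_ne_zero_iff.mpr hv)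
      (norm_ne_zero_iff.mpr (hz k))]
  let r (k : ℕ) : ℝ := (L k).re / s.re
  have hr : Tendsto r atTop atTop := by
    have h := tendsto_atTop_add_const_left atTop (Real.log ‖v‖ / Real.log ‖μ‖)
      (tendsto_neg_atBot_atTop.comp hlog)
    refine h.congr fun k => ?_
    simp only [r, hLre, hsre, Function.comp_apply]
    ring
  let n (k : ℕ) : ℕ := ⌊r k⌋₊
  have hn : Tendsto n atTop atTop := tendsto_nat_floor_atTop.comp hr
  have hnr : Tendsto (fun k => (n k : ℝ)) atTop atTop := tendsto_natCast_atTop_atTop.comp hn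
  let m (k : ℕ) : ℤ := round ((n k * s.im - (L k).im) / (2 * Real.pi))
  let p (k : ℕ) : ℂ := (L k + m k * (2 * Real.pi * Complex.I)) / n k
  have hpre : Tendsto (fun k => (p k).re) atTop (𝓝 s.re) := by
    have h := ((tendsto_nat_floor_div_atTop (R := ℝ)).comp hr).inv₀ one_ne_zero
    have h' := h.const_mul s.re
    rw [inv_one, mul_one] at h'
    refine h'.congr fun k => ?_
    have : (p k).re = (L k).re / n k := by
      simp [p, Complex.div_natCast_re]
    rw [this]
    have h0 : s.re ≠ 0 := by rwa [hsre]
    simp only [Function.comp_apply, r, n, inv_div]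
    field_simp
  have hpim : Tendsto (fun k => (p k).im) atTop (𝓝 s.im) := by
    rw [tendsto_iff_dist_tendsto_zero]
    refine squeeze_zero' (Eventually.of_forall fun _ => dist_nonneg) ?_
      ((tendsto_const_nhds (x := Real.pi)).div_atTop hnr)
    filter_upwards [hnr.eventually_gt_atTop 0] with k hk
    have : (p k).im = ((L k).im + m k * (2 * Real.pi)) / n k := by
      simp [p, Complex.div_natCast_im]
    rw [this, Real.dist_eq]
    have hround := abs_sub_round ((n k * s.im - (L k).im) / (2 * Real.pi))
    have hpi := Real.pi_pos
    have key : ((L k).im + m k * (2 * Real.pi)) / n k - s.im =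
        -(((n k * s.im - (L k).im) / (2 * Real.pi) - m k) * (2 * Real.pi) / n k) := by
      field_simp
      ring
    rw [key, abs_neg, abs_div, abs_mul, abs_of_pos hk, abs_of_pos (by positivity : 0 < 2 * Real.pi)]
    gcongr
    calc _ ≤ 1 / 2 * (2 * Real.pi) := by gcongr
      _ = Real.pi := by ring
  have hp : Tendsto p atTop (𝓝 s) := by
    have h := (Complex.equivRealProdCLM.symm.continuous.tendsto (s.re, s.im)).comp
      (hpre.prodMk_nhds hpim)
    simpa [Function.comp_def, Complex.equivRealProdCLM_symm_apply] using h
  refine ⟨n, fun k => Complex.exp (p k), hn, ?_, ?_⟩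
  · have := (Complex.continuous_exp.tendsto s).comp hp
    rwa [hs, Complex.exp_log hμ] at this
  · filter_upwards [hn.eventually_gt_atTop 0] with k hk
    have hk' : (n k : ℂ) ≠ 0 := Nat.cast_ne_zero.mpr hk.ne'
    rw [← Complex.exp_nat_mul, mul_div_cancel₀ _ hk', Complex.exp_add,
      Complex.exp_int_mul_two_pi_mul_I, mul_one, Complex.exp_log (div_ne_zero hv (hz k)),
      mul_div_cancel₀ _ (hz k)]

lemma exists_dense_scaled_orbit {M : Type*} [NormedAddCommGroup M] [NormedSpace ℂ M]
    [CompleteSpace M] [TopologicalSpace.SeparableSpace M] {S F : M →L[ℂ] M}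
    (hSF : ∀ x, S (F x) = x) (hF : ∀ x, ‖F x‖ ≤ 3⁻¹ * ‖x‖)
    (hS : Dense {x | ∃ n₀, ∀ n ≥ n₀, (S ^ n) x = 0})
    {z : ℕ → ℂ} (hz : ∀ k, z k ≠ 0) {U : Set ℂ} (hUo : IsOpen U) (hUne : U.Nonempty)
    (hU : ∀ μ ∈ U, ‖μ‖ < 2)
    (hlog : ∀ μ ∈ U, Tendsto (fun k => Real.log ‖z k‖ / Real.log ‖μ‖) atTop atBot) :
    ∃ (μ : ℂ) (w : M), Dense {p : ℂ × M | ∃ n ≥ 1, ∃ k, p = (z k * μ ^ n, z k • (S ^ n) w)} := by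
  have : SecondCountableTopology M := UniformSpace.secondCountable_of_separable M
  have hSFn (n : ℕ) (x : M) : (S ^ n) ((F ^ n) x) = x := by
    induction n generalizing x with
    | zero => simp
    | succ n ih =>
      rw [pow_succ, pow_succ', mul_apply_eq_comp, mul_apply_eq_comp,
        hSF, ih]
  have hFn (n : ℕ) (x : M) : ‖(F ^ n) x‖ ≤ 3⁻¹ ^ n * ‖x‖ := by
    induction n with
    | zero => simp
    | succ n ih =>
      rw [pow_succ', mul_apply_eq_comp, pow_succ', mul_assoc]
      exact (hF _).trans (by gcongr)
  let O (B : Set (ℂ × M)) : Set (U × M) :=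
    {q | ∃ n ≥ 1, ∃ k, (z k * (q.1 : ℂ) ^ n, z k • (S ^ n) q.2) ∈ B}
  let bas := TopologicalSpace.countableBasis (ℂ × M)
  have hO_open : ∀ B ∈ bas, IsOpen (O B) := by
    intro B hB
    have hBo := TopologicalSpace.isOpen_of_mem_countableBasis hB
    have : O B = ⋃ n ≥ 1, ⋃ k,
        (fun q : U × M => (z k * (q.1 : ℂ) ^ n, z k • (S ^ n) q.2)) ⁻¹' B := by
      ext q
      simp [O]
    rw [this]
    refine isOpen_biUnion fun n _ => isOpen_iUnion fun k => hBo.preimage ?_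
    fun_prop
  have hO_dense : ∀ B ∈ bas, Dense (O B) := by
    intro B hB
    have hBo := TopologicalSpace.isOpen_of_mem_countableBasis hB
    have hBne := TopologicalSpace.nonempty_of_mem_countableBasis hB
    obtain ⟨⟨v, y⟩, hvy, hv⟩ : ∃ q ∈ B, q.1 ≠ 0 := by
      obtain ⟨q, hq1, hq2⟩ := ((dense_compl_singleton (0 : ℂ)).prod
        (dense_univ (X := M))).inter_open_nonempty B hBo hBne
      exact ⟨q, hq1, hq2.1⟩
    rw [dense_iff_inter_open]
    rintro G hG ⟨⟨μ₀, w₁⟩, hμw⟩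
    obtain ⟨G₁, G₂, hG₁, hG₂, hμG, hwG, hGG⟩ := isOpen_prod_iff.mp hG μ₀ w₁ hμw
    obtain ⟨w₀, hw₀, n₀, hn₀⟩ := hS.inter_open_nonempty G₂ hG₂ ⟨w₁, hwG⟩
    obtain ⟨n, ν, hn, hν, hpow⟩ := exists_tendsto_pow_eq hz hv (hlog μ₀ μ₀.2)
    have hνU : ∀ᶠ k in atTop, ∃ h : ν k ∈ U, (⟨ν k, h⟩ : U) ∈ G₁ := by
      obtain ⟨G', hG', rfl⟩ := isOpen_induced_iff.mp hG₁
      filter_upwards [hν.eventually (hUo.mem_nhds μ₀.2), hν.eventually (hG'.mem_nhds hμG)]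
        with k h1 h2
      exact ⟨h1, h2⟩
    have hw : Tendsto (fun k => w₀ + (z k)⁻¹ • (F ^ n k) y) atTop (𝓝 w₀) := by
      suffices Tendsto (fun k => (z k)⁻¹ • (F ^ n k) y) atTop (𝓝 0) by
        simpa using this.const_add w₀
      have hgeom : Tendsto (fun k => (2 / 3 : ℝ) ^ n k * (‖y‖ / ‖v‖)) atTop (𝓝 0) := by
        simpa using ((tendsto_pow_atTop_nhds_zero_of_lt_one (by norm_num : (0 : ℝ) ≤ 2 / 3)
          (by norm_num)).comp hn).mul_const (‖y‖ / ‖v‖)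
      refine squeeze_zero_norm' ?_ hgeom
      filter_upwards [hpow, hνU] with k hk hkU
      have hinv : (z k)⁻¹ = ν k ^ n k / v := by
        rw [← hk]
        have hνk : ν k ^ n k ≠ 0 := by
          intro h
          rw [h, mul_zero] at hk
          exact hv hk.symm
        have := hz k
        field_simp
      rw [hinv, norm_smul, norm_div, norm_pow]
      calc ‖ν k‖ ^ n k / ‖v‖ * ‖(F ^ n k) y‖ ≤ 2 ^ n k / ‖v‖ * (3⁻¹ ^ n k * ‖y‖) := by
            gcongr
            · exact (hU _ hkU.1).le
            · exact hFn _ _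
        _ = (2 / 3 : ℝ) ^ n k * (‖y‖ / ‖v‖) := by
            rw [div_eq_mul_inv 2 (3 : ℝ), mul_pow]
            ring
    obtain ⟨k, hk, ⟨hkU, hkG⟩, hkw, hkn⟩ := (hpow.and (hνU.and
      ((hw.eventually (hG₂.mem_nhds hw₀)).and (hn.eventually_ge_atTop (max 1 n₀))))).exists
    refine ⟨(⟨ν k, hkU⟩, w₀ + (z k)⁻¹ • (F ^ n k) y), hGG ⟨hkG, hkw⟩, n k,
      le_of_max_le_left hkn, k, ?_⟩
    rwa [hk, map_add, map_smul, hn₀ _ (le_of_max_le_right hkn), hSFn, zero_add,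
      smul_inv_smul₀ (hz k)]
  have : BaireSpace (U × M) := by
    have h : IsOpen (U ×ˢ (Set.univ : Set M)) := hUo.prod isOpen_univ
    have := h.baireSpace
    exact ((Homeomorph.Set.prod U (Set.univ : Set M)).trans
      ((Homeomorph.refl U).prodCongr (Homeomorph.Set.univ M))).baireSpace
  have : Nonempty (U × M) := ⟨(⟨_, hUne.some_mem⟩, 0)⟩
  obtain ⟨⟨μ, w⟩, hq⟩ := (dense_biInter_of_isOpen hO_open
    (TopologicalSpace.countable_countableBasis _) hO_dense).nonempty
  refine ⟨μ, w, ?_⟩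
  rw [(TopologicalSpace.isBasis_countableBasis (ℂ × M)).dense_iff]
  intro B hB hBne
  obtain ⟨n, hn, k, hk⟩ := Set.mem_iInter₂.mp hq B hB
  exact ⟨_, hk, n, hn, k, rfl⟩

lemma exists_equiv_prod_ker {H : Type*} [NormedAddCommGroup H] [NormedSpace ℂ H]
    (g : H →L[ℂ] ℂ) {v : H} (hv : g v = 1) (w : LinearMap.ker g.toLinearMap) :
    ∃ Φ : H ≃L[ℂ] ℂ × LinearMap.ker g.toLinearMap,
      ∀ x, (Φ x).1 = g x ∧ ((Φ x).2 : H) = x - g x • v + g x • (w : H) := by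
  let M := LinearMap.ker g.toLinearMap
  have hM (x : M) : g x = 0 := x.2
  let P : H →L[ℂ] M := (ContinuousLinearMap.id ℂ H - g.smulRight v).codRestrict M fun x => by
    simp [M, hv]
  have hP (x : H) : (P x : H) = x - g x • v := rfl
  let f₁ : H →L[ℂ] ℂ × M := g.prod (P + g.smulRight w)
  let f₂ : ℂ × M →L[ℂ] H := (ContinuousLinearMap.fst ℂ ℂ M).smulRight v +
    M.subtypeL ∘L ContinuousLinearMap.snd ℂ ℂ M -
    (ContinuousLinearMap.fst ℂ ℂ M).smulRight (w : H)
  have h₁ (x : H) : f₁ x = (g x, P x + g x • w) := rfl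
  have h₂ (p : ℂ × M) : f₂ p = p.1 • v + (p.2 : H) - p.1 • (w : H) := rfl
  refine ⟨ContinuousLinearEquiv.equivOfInverse f₁ f₂ (fun x => ?_) (fun p => ?_),
    fun x => ⟨rfl, rfl⟩⟩
  · rw [h₂, h₁]
    simp only [Submodule.coe_add, Submodule.coe_smul, hP]
    abel
  · have hg : g (f₂ p) = p.1 := by simp [h₂, hv, hM]
    rw [h₁, hg]
    refine Prod.ext rfl (Subtype.ext ?_)
    rw [Submodule.coe_add, Submodule.coe_smul, hP, hg, h₂]
    abel

/-- A sequence in a finite-dimensional subspace whose values under a functional tend to `0` or to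
infinity has a dense joint orbit under some operator without hypercyclic vectors. -/
lemma exists_dense_orbit_not_hypercyclic {H : Type*} [NormedAddCommGroup H] [InnerProductSpace ℂ H]
    [CompleteSpace H] [TopologicalSpace.SeparableSpace H] (hH : ¬ FiniteDimensional ℂ H)
    {E : Submodule ℂ H} [FiniteDimensional ℂ E] {g : H →L[ℂ] ℂ} {v : H} (hvE : v ∈ E)
    (hv : g v = 1) {c : ℕ → H} (hc : ∀ k, c k ∈ E) (hz : ∀ k, g (c k) ≠ 0)
    {U : Set ℂ} (hUo : IsOpen U) (hUne : U.Nonempty) (hU : ∀ μ ∈ U, ‖μ‖ < 2)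
    (hlog : ∀ μ ∈ U, Tendsto (fun k => Real.log ‖g (c k)‖ / Real.log ‖μ‖) atTop atBot) :
    ∃ T : H →L[ℂ] H, Dense {y : H | ∃ n : ℕ, ∃ k, y = (T ^ n) (c k)} ∧
      ∀ x, ¬ Dense (Set.range fun n : ℕ => (T ^ n) x) := by
  let M := LinearMap.ker g.toLinearMap
  have hMc : CompleteSpace M := g.isClosed_ker.completeSpace_coe
  have : SecondCountableTopology H := UniformSpace.secondCountable_of_separable H
  have hM : ¬ FiniteDimensional ℂ M := by
    intro _
    obtain ⟨Φ, -⟩ := exists_equiv_prod_ker g hv 0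
    exact hH Φ.symm.toLinearEquiv.finiteDimensional
  let N : Submodule ℂ M := E.comap M.subtype
  have : FiniteDimensional ℂ N := by
    let f : N →ₗ[ℂ] E := (M.subtype ∘ₗ N.subtype).codRestrict E fun x => x.2
    exact FiniteDimensional.of_injective f fun x y h =>
      Subtype.ext (Subtype.ext (congrArg (fun e : E => (e : H)) h : ((x : M) : H) = ((y : M) : H)))
  obtain ⟨S, F, hSF, hF, hSN, hSd⟩ := exists_scaled_backward_shift hM N
  obtain ⟨μ, w, hd⟩ := exists_dense_scaled_orbit hSF hF hSd hz hUo hUne hU hlog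
  obtain ⟨Φ, hΦ⟩ := exists_equiv_prod_ker g hv w
  let R : ℂ × M →L[ℂ] ℂ × M := (μ • ContinuousLinearMap.fst ℂ ℂ M).prod
    (S ∘L ContinuousLinearMap.snd ℂ ℂ M)
  let T : H →L[ℂ] H := Φ.symm.toContinuousLinearMap ∘L R ∘L Φ.toContinuousLinearMap
  have hT (x : H) : T x = Φ.symm (μ * (Φ x).1, S (Φ x).2) := rfl
  have hTn (n : ℕ) (x : H) : (T ^ n) x = Φ.symm (μ ^ n * (Φ x).1, (S ^ n) (Φ x).2) := by
    induction n with
    | zero => simp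
    | succ n ih =>
      rw [pow_succ', mul_apply_eq_comp, ih, hT, Φ.apply_symm_apply, pow_succ', pow_succ',
        mul_apply_eq_comp, mul_assoc]
  refine ⟨T, ?_, fun x => not_dense_orbit_of_dual_eigenvector (g := g) (μ := μ) ?_ ?_ x⟩
  · refine (Φ.symm.surjective.denseRange.dense_image Φ.symm.continuous hd).mono ?_
    rintro _ ⟨_, ⟨n, hn, k, rfl⟩, rfl⟩
    refine ⟨n, k, ?_⟩
    obtain ⟨j, rfl⟩ := Nat.exists_eq_add_of_le' hn
    have hmem : (Φ (c k)).2 - g (c k) • w ∈ N := by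
      change ((Φ (c k)).2 : H) - g (c k) • (w : H) ∈ E
      rw [(hΦ (c k)).2, add_sub_cancel_right]
      exact E.sub_mem (hc k) (E.smul_mem _ hvE)
    have hS : S (Φ (c k)).2 = g (c k) • S w := by
      rw [← sub_eq_zero, ← map_smul, ← map_sub]
      exact hSN _ hmem
    rw [hTn, (hΦ (c k)).1, pow_succ S, mul_apply_eq_comp, mul_apply_eq_comp, hS, map_smul, mul_comm]
  · rintro rfl
    simp at hv
  · intro x
    rw [← (hΦ (T x)).1, hT, Φ.apply_symm_apply, (hΦ x).1]

section HypercyclicSubset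

variable {H : Type*} [NormedAddCommGroup H] [InnerProductSpace ℂ H] [CompleteSpace H]
  [TopologicalSpace.SeparableSpace H] {C : Set H} {E : Submodule ℂ H} [FiniteDimensional ℂ E]

lemma false_of_sequence_in_hypercyclic_subset (hH : ¬ FiniteDimensional ℂ H)
    (hCE : C ⊆ (E : Set H))
    (hhyp : ∀ T : H →L[ℂ] H, Dense {y : H | ∃ n : ℕ, ∃ c ∈ C, y = (T ^ n) c} →
      ∃ x : H, Dense (Set.range fun n : ℕ => (T ^ n) x))
    {g : H →L[ℂ] ℂ} {c : ℕ → H} (hc : ∀ k, c k ∈ C) (hz : ∀ k, g (c k) ≠ 0)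
    {U : Set ℂ} (hUo : IsOpen U) (hUne : U.Nonempty) (hU : ∀ μ ∈ U, ‖μ‖ < 2)
    (hlog : ∀ μ ∈ U, Tendsto (fun k => Real.log ‖g (c k)‖ / Real.log ‖μ‖) atTop atBot) :
    False := by
  obtain ⟨T, hT, hT'⟩ := exists_dense_orbit_not_hypercyclic hH
    (E.smul_mem (g (c 0))⁻¹ (hCE (hc 0))) (by simp [hz 0]) (fun k => hCE (hc k)) hz hUo hUne hU hlog
  obtain ⟨x, hx⟩ := hhyp T (hT.mono (by rintro y ⟨n, k, h⟩; exact ⟨n, c k, hc k, h⟩))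
  exact hT' x hx

lemma eventually_eq_zero_of_tendsto_zero (hH : ¬ FiniteDimensional ℂ H)
    (hCE : C ⊆ (E : Set H))
    (hhyp : ∀ T : H →L[ℂ] H, Dense {y : H | ∃ n : ℕ, ∃ c ∈ C, y = (T ^ n) c} →
      ∃ x : H, Dense (Set.range fun n : ℕ => (T ^ n) x))
    (g : H →L[ℂ] ℂ) {c : ℕ → H} (hc : ∀ k, c k ∈ C)
    (h0 : Tendsto (fun k => g (c k)) atTop (𝓝 0)) : ∀ᶠ k in atTop, g (c k) = 0 := by
  by_contra h
  obtain ⟨φ, hφ, hz⟩ := extraction_of_frequently_atTop (not_eventually.mp h)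
  refine false_of_sequence_in_hypercyclic_subset hH hCE hhyp (c := c ∘ φ) (fun k => hc _) hz
    (U := {μ | 1 < ‖μ‖ ∧ ‖μ‖ < 2})
    ((isOpen_lt continuous_const continuous_norm).inter (isOpen_lt continuous_norm continuous_const))
    ⟨((3 / 2 : ℝ) : ℂ), ?_⟩ (fun μ hμ => hμ.2) fun μ hμ => ?_
  · rw [Set.mem_ofPred_eq, Complex.norm_real, Real.norm_of_nonneg (by norm_num)]
    norm_num
  · refine Tendsto.atBot_div_const (Real.log_pos hμ.1) ?_
    refine Real.tendsto_log_nhdsGT_zero.comp (tendsto_nhdsWithin_iff.mpr ⟨?_, ?_⟩)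
    · simpa using (h0.comp hφ.tendsto_atTop).norm
    · exact Eventually.of_forall fun k => norm_pos_iff.mpr (hz k)

lemma exists_norm_apply_le (hH : ¬ FiniteDimensional ℂ H) (hCE : C ⊆ (E : Set H))
    (hhyp : ∀ T : H →L[ℂ] H, Dense {y : H | ∃ n : ℕ, ∃ c ∈ C, y = (T ^ n) c} →
      ∃ x : H, Dense (Set.range fun n : ℕ => (T ^ n) x))
    (g : H →L[ℂ] ℂ) : ∃ B, ∀ c ∈ C, ‖g c‖ ≤ B := by
  by_contra! h
  choose c hc hlt using fun k : ℕ => h k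
  have hz (k : ℕ) : g (c k) ≠ 0 := norm_pos_iff.mp ((Nat.cast_nonneg k).trans_lt (hlt k))
  refine false_of_sequence_in_hypercyclic_subset hH hCE hhyp hc hz
    (U := {μ | 0 < ‖μ‖ ∧ ‖μ‖ < 1})
    ((isOpen_lt continuous_const continuous_norm).inter (isOpen_lt continuous_norm continuous_const))
    ⟨((1 / 2 : ℝ) : ℂ), ?_⟩ (fun μ hμ => hμ.2.trans (by norm_num)) fun μ hμ => ?_
  · rw [Set.mem_ofPred_eq, Complex.norm_real, Real.norm_of_nonneg (by norm_num)]
    norm_num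
  · refine Tendsto.atTop_div_const_of_neg (Real.log_neg hμ.1 hμ.2) ?_
    exact Real.tendsto_log_atTop.comp
      (tendsto_atTop_mono (fun k => (hlt k).le) tendsto_natCast_atTop_atTop)

lemma isBounded_of_hypercyclic_subset (hH : ¬ FiniteDimensional ℂ H) (hCE : C ⊆ (E : Set H))
    (hhyp : ∀ T : H →L[ℂ] H, Dense {y : H | ∃ n : ℕ, ∃ c ∈ C, y = (T ^ n) c} →
      ∃ x : H, Dense (Set.range fun n : ℕ => (T ^ n) x)) : Bornology.IsBounded C := by
  let o := stdOrthonormalBasis ℂ E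
  choose B hB using fun i => exists_norm_apply_le hH hCE hhyp (innerSL ℂ (o i : H))
  refine isBounded_iff_forall_norm_le.mpr ⟨∑ i, B i, fun c hc => ?_⟩
  have hsum : c = ∑ i, inner ℂ (o i : H) c • (o i : H) := by
    have := congrArg (Subtype.val) (o.sum_repr' ⟨c, hCE hc⟩)
    simpa using this.symm
  calc ‖c‖ = ‖∑ i, inner ℂ (o i : H) c • (o i : H)‖ := by rw [← hsum]
    _ ≤ ∑ i, ‖inner ℂ (o i : H) c • (o i : H)‖ := norm_sum_le _ _
    _ ≤ ∑ i, B i := Finset.sum_le_sum fun i _ => by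
        have h1 : ‖(o i : H)‖ = 1 := o.orthonormal.1 i
        rw [norm_smul, h1, mul_one]
        exact hB i c hc

/-- In a finite-dimensional hypercyclic subset, convergent sequences are eventually collinear with
their limit. -/
lemma eventually_mem_span_singleton (hH : ¬ FiniteDimensional ℂ H) (hCE : C ⊆ (E : Set H))
    (hhyp : ∀ T : H →L[ℂ] H, Dense {y : H | ∃ n : ℕ, ∃ c ∈ C, y = (T ^ n) c} →
      ∃ x : H, Dense (Set.range fun n : ℕ => (T ^ n) x))
    {c : ℕ → H} (hc : ∀ k, c k ∈ C) {c₀ : H} (hc₀ : c₀ ∈ E) (hlim : Tendsto c atTop (𝓝 c₀)) :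
    ∀ᶠ k in atTop, c k ∈ ℂ ∙ c₀ := by
  let N : Submodule ℂ H := E ⊓ (ℂ ∙ c₀)ᗮ
  have hNfd : FiniteDimensional ℂ N := Submodule.finiteDimensional_inf_left E (ℂ ∙ c₀)ᗮ
  obtain ⟨s, hs⟩ := (Submodule.fg_iff_finiteDimensional N).mpr hNfd
  have hev : ∀ᶠ k in atTop, ∀ b ∈ s, inner ℂ b (c k) = 0 := by
    rw [Filter.eventually_all_finset]
    intro b hb
    have hbN : b ∈ N := hs ▸ Submodule.subset_span hb
    refine eventually_eq_zero_of_tendsto_zero hH hCE hhyp (innerSL ℂ b) hc ?_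
    have h := ((innerSL ℂ b).continuous.tendsto c₀).comp hlim
    have h0 : innerSL ℂ b c₀ = 0 :=
      Submodule.inner_left_of_mem_orthogonal (Submodule.mem_span_singleton_self c₀) hbN.2
    rwa [h0] at h
  filter_upwards [hev] with k hk
  obtain ⟨p, hp, q, hq, hpq⟩ := (ℂ ∙ c₀).exists_add_mem_mem_orthogonal (c k)
  have hpE : p ∈ E := (Submodule.span_singleton_le_iff_mem c₀ E).mpr hc₀ hp
  have hqN : q ∈ N := ⟨by
    rw [← add_sub_cancel_left p q, ← hpq]
    exact E.sub_mem (hCE (hc k)) hpE, hq⟩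
  have horth (q : H) (hq : q ∈ Submodule.span ℂ (s : Set H)) : inner ℂ q (c k) = 0 := by
    induction hq using Submodule.span_induction with
    | mem x hx => exact hk x hx
    | zero => simp
    | add x y _ _ hx hy => rw [inner_add_left, hx, hy, add_zero]
    | smul a x _ hx => rw [inner_smul_left, hx, mul_zero]
  have hqc := horth q (hs ▸ hqN)
  rw [hpq, inner_add_right, Submodule.inner_left_of_mem_orthogonal hp hq, zero_add,
    inner_self_eq_zero] at hqc
  rwa [hpq, hqc, add_zero]

end HypercyclicSubset

lemma dense_orbit_of_mem_closure_orbit {H : Type*} [NormedAddCommGroup H] [NormedSpace ℂ H]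
    {T : H →L[ℂ] H} {x y : H} (hy : Dense (Set.range fun n : ℕ => (T ^ n) y))
    (hyx : y ∈ closure (Set.range fun n : ℕ => (T ^ n) x)) :
    Dense (Set.range fun n : ℕ => (T ^ n) x) := by
  refine dense_closure.mp (hy.mono ?_)
  rintro _ ⟨n, rfl⟩
  refine map_mem_closure (T ^ n).continuous hyx ?_
  rintro _ ⟨m, rfl⟩
  exact ⟨n + m, by simp only [pow_add, mul_apply_eq_comp]⟩

lemma dense_orbit_smul {H : Type*} [NormedAddCommGroup H] [NormedSpace ℂ H]
    {T : H →L[ℂ] H} {x : H} (hx : Dense (Set.range fun n : ℕ => (T ^ n) x)) {a : ℂ} (ha : a ≠ 0) :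
    Dense (Set.range fun n : ℕ => (T ^ n) (a • x)) := by
  have hsurj : Function.Surjective fun y : H => a • y := fun y => ⟨a⁻¹ • y, smul_inv_smul₀ ha y⟩
  have := hsurj.denseRange.dense_image (continuous_const_smul a) hx
  rw [← Set.range_comp] at this
  simpa only [Function.comp_def, map_smul] using this

/-- If a finite-dimensional subset `C` of a separable Hilbert space is a hypercyclic subset,
then every `C`-hypercyclic operator admits a hypercyclic vector belonging to `C`. -/
theorem stmt_18 {H : Type*} [NormedAddCommGroup H] [InnerProductSpace ℂ H] [CompleteSpace H]
    [TopologicalSpace.SeparableSpace H]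
    (C : Set H)
    (hfd : ∃ E : Submodule ℂ H, FiniteDimensional ℂ E ∧ C ⊆ (E : Set H))
    (hne : (C \ {0}).Nonempty)
    (hhyp : ∀ T : H →L[ℂ] H, Dense {y : H | ∃ n : ℕ, ∃ c ∈ C, y = (T ^ n) c} →
      ∃ x : H, Dense (Set.range fun n : ℕ => (T ^ n) x)) :
    ∀ T : H →L[ℂ] H, Dense {y : H | ∃ n : ℕ, ∃ c ∈ C, y = (T ^ n) c} →
      ∃ x ∈ C, Dense (Set.range fun n : ℕ => (T ^ n) x) := by
  intro T hT
  obtain ⟨E, hE, hCE⟩ := hfd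
  obtain ⟨e, -, he⟩ := hne
  have : Nontrivial H := ⟨e, 0, he⟩
  obtain ⟨y, hy⟩ := hhyp T hT
  have hy0 : y ≠ 0 := by
    rintro rfl
    have hmem := hy e
    simp only [map_zero, Set.range_const, closure_singleton] at hmem
    exact he hmem
  have hH := not_finiteDimensional_of_dense_orbit hy
  obtain ⟨u, hu, hulim⟩ := mem_closure_iff_seq_limit.mp (hT y)
  choose n c hc huc using hu
  obtain ⟨c₀, hc₀, φ, hφ, hlim⟩ : ∃ c₀ ∈ E, ∃ φ : ℕ → ℕ, StrictMono φ ∧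
      Tendsto (c ∘ φ) atTop (𝓝 c₀) := by
    obtain ⟨B, hB⟩ :=
      isBounded_iff_forall_norm_le.mp (isBounded_of_hypercyclic_subset hH hCE hhyp)
    obtain ⟨a, -, φ, hφ, hlim⟩ := (isCompact_closedBall (0 : E) B).tendsto_subseq
      (x := fun k => (⟨c k, hCE (hc k)⟩ : E))
      fun k => mem_closedBall_zero_iff.mpr (hB (c k) (hc k))
    exact ⟨a, a.2, φ, hφ, (continuous_subtype_val.tendsto a).comp hlim⟩
  have hspan := eventually_mem_span_singleton hH hCE hhyp (fun k => hc (φ k)) hc₀ hlim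
  have hulim' : Tendsto (fun k => (T ^ n (φ k)) (c (φ k))) atTop (𝓝 y) := by
    simpa only [Function.comp_def, huc] using hulim.comp hφ.tendsto_atTop
  have hc₀_ne : c₀ ≠ 0 := by
    rintro rfl
    refine hy0 (tendsto_nhds_unique hulim' (tendsto_const_nhds.congr' ?_))
    filter_upwards [hspan] with k hk
    rw [Submodule.span_zero_singleton, Submodule.mem_bot] at hk
    rw [hk, map_zero]
  choose! α hα using fun k (hk : c (φ k) ∈ ℂ ∙ c₀) => Submodule.mem_span_singleton.mp hk
  have hinner : inner ℂ c₀ c₀ ≠ 0 := inner_self_ne_zero.mpr hc₀_ne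
  have hαlim : Tendsto α atTop (𝓝 1) := by
    have h := (((innerSL ℂ c₀).continuous.tendsto c₀).comp hlim).div_const (inner ℂ c₀ c₀)
    rw [innerSL_apply_apply, div_self hinner] at h
    refine h.congr' ?_
    filter_upwards [hspan] with k hk
    simp only [Function.comp_apply, innerSL_apply_apply]
    rw [← hα k hk, inner_smul_right, mul_div_cancel_right₀ _ hinner]
  have hα0 := hαlim.eventually_ne one_ne_zero
  have hyc₀ : y ∈ closure (Set.range fun n : ℕ => (T ^ n) c₀) := by
    have h := (hαlim.inv₀ one_ne_zero).smul hulim'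
    rw [inv_one, one_smul] at h
    refine mem_closure_of_tendsto h ?_
    filter_upwards [hspan, hα0] with k hk hk0
    refine ⟨n (φ k), ?_⟩
    change (T ^ n (φ k)) c₀ = (α k)⁻¹ • (T ^ n (φ k)) (c (φ k))
    rw [← hα k hk, map_smul, inv_smul_smul₀ hk0]
  obtain ⟨k, hk, hk0⟩ := (hspan.and hα0).exists
  refine ⟨c (φ k), hc _, ?_⟩
  rw [← hα k hk]
  exact dense_orbit_smul (dense_orbit_of_mem_closure_orbit hy hyc₀) hk0
end
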